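/- For every n ≤ 5 and every k with 2 ≤ k ≤ n, the maximum, over all DFAs with n states and all subsets S of size k of the state set such that some word synchronizes S, of the length of a shortest word synchronizing S, equals T(n,k), where T(3,2)=3, T(3,3)=4, T(4,2)=6, T(4,3)=8, T(4,4)=9, T(5,2)=10, T(5,3)=13, T(5,4)=15, T(5,5)=16. Moreover, if a DFA with n ≤ 5 states is not synchronizing and a subset S of size k of its states is synchronized by some word, then the shortest word synchronizing S has length strictly less than T(n,k). -/

import Mathlib

/-- Action of a DFA transition function on a subset of states along a word. -/
def dfaRun {n m : ℕ} (δ : Fin n → Fin m → Fin n) :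
    Finset (Fin n) → List (Fin m) → Finset (Fin n)
  | S, [] => S
  | S, a :: w => dfaRun δ (S.image fun q => δ q a) w

/-- A word `w` synchronizes the subset `S` in the DFA `δ`. -/
def dfaSync {n m : ℕ} (δ : Fin n → Fin m → Fin n) (S : Finset (Fin n))
    (w : List (Fin m)) : Prop :=
  (dfaRun δ S w).card = 1

/-- `l` is the length of a shortest word synchronizing `S` in the DFA `δ`. -/
def dfaShortestSync {n m : ℕ} (δ : Fin n → Fin m → Fin n) (S : Finset (Fin n))
    (l : ℕ) : Prop :=
  (∃ w, dfaSync δ S w ∧ w.length = l) ∧ ∀ w, dfaSync δ S w → l ≤ w.length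

/-- The table of maximum subset synchronization lengths for DFAs with up to 5 states. -/
def T0 : ℕ → ℕ → ℕ
  | 3, 2 => 3
  | 3, 3 => 4
  | 4, 2 => 6
  | 4, 3 => 8
  | 4, 4 => 9
  | 5, 2 => 10
  | 5, 3 => 13
  | 5, 4 => 15
  | 5, 5 => 16
  | _, _ => 0

section Levels

variable {n : ℕ} {α : Type} (f : α → Fin n → Fin n)

/-- `SyncIn f i S`: some word of length at most `i` maps `S` to a set of at most one state. -/
def SyncIn : ℕ → Finset (Fin n) → Prop
  | 0, S => S.card ≤ 1
  | i + 1, S => SyncIn i S ∨ ∃ a, SyncIn i (S.image (f a))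

/-- The shortest word compressing `S` to at most one state has length exactly `i`. -/
def SyncAt (i : ℕ) (S : Finset (Fin n)) : Prop :=
  SyncIn f i S ∧ ∀ j < i, ¬ SyncIn f j S

/-- Each length from `1` to `L` is the exact length for some set of at most `k` states. -/
def LevelsUpTo (k L : ℕ) : Prop :=
  ∀ i, 1 ≤ i → i ≤ L → ∃ S : Finset (Fin n), S.card ≤ k ∧ SyncAt f i S

variable {f}

theorem SyncIn.succ {i : ℕ} {S : Finset (Fin n)} (h : SyncIn f i S) : SyncIn f (i + 1) S :=
  Or.inl h

theorem SyncIn.mono {i j : ℕ} (hij : i ≤ j) {S : Finset (Fin n)} (h : SyncIn f i S) :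
    SyncIn f j S := by
  induction hij with
  | refl => exact h
  | step _ ih => exact ih.succ

theorem SyncIn.anti {i : ℕ} {S T : Finset (Fin n)} (hST : S ⊆ T) (h : SyncIn f i T) :
    SyncIn f i S := by
  induction i generalizing S T with
  | zero => exact (Finset.card_le_card hST).trans h
  | succ i ih =>
    rcases h with h | ⟨a, h⟩
    · exact Or.inl (ih hST h)
    · exact Or.inr ⟨a, ih (Finset.image_subset_image hST) h⟩

theorem syncIn_of_card_le_one {S : Finset (Fin n)} (h : S.card ≤ 1) (i : ℕ) : SyncIn f i S :=
  SyncIn.mono (Nat.zero_le i) (show SyncIn f 0 S from h)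

theorem SyncIn.exists_syncAt {i : ℕ} {S : Finset (Fin n)} (h : SyncIn f i S) :
    ∃ j ≤ i, SyncAt f j S := by
  classical
  have hex : ∃ j, SyncIn f j S := ⟨i, h⟩
  exact ⟨Nat.find hex, Nat.find_min' hex h, Nat.find_spec hex, fun j hj => Nat.find_min hex hj⟩

theorem SyncAt.unique {i j : ℕ} {S : Finset (Fin n)} (hi : SyncAt f i S) (hj : SyncAt f j S) :
    i = j := by
  by_contra hne
  rcases Nat.lt_or_gt_of_ne hne with h | h
  · exact hj.2 i h hi.1
  · exact hi.2 j h hj.1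

theorem syncAt_succ_iff {i : ℕ} {S : Finset (Fin n)} :
    SyncAt f (i + 1) S ↔ SyncIn f (i + 1) S ∧ ¬ SyncIn f i S :=
  ⟨fun h => ⟨h.1, h.2 i (Nat.lt_succ_self i)⟩,
    fun h => ⟨h.1, fun _ hj hs => h.2 (hs.mono (Nat.le_of_lt_succ hj))⟩⟩

theorem syncAt_image {i : ℕ} {S : Finset (Fin n)} (h : ¬ SyncIn f i S) {a : α}
    (ha : SyncIn f i (S.image (f a))) : SyncAt f i (S.image (f a)) := by
  refine ⟨ha, fun j hj hs => h ?_⟩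
  exact SyncIn.mono hj (show SyncIn f (j + 1) S from Or.inr ⟨a, hs⟩)

theorem SyncAt.exists_image {i : ℕ} {S : Finset (Fin n)} (h : SyncAt f (i + 1) S) :
    ∃ a, SyncAt f i (S.image (f a)) := by
  rw [syncAt_succ_iff] at h
  rcases h.1 with h' | ⟨a, ha⟩
  · exact absurd h' h.2
  · exact ⟨a, syncAt_image h.2 ha⟩

theorem SyncAt.one_lt_card {i : ℕ} (hi : 1 ≤ i) {S : Finset (Fin n)} (h : SyncAt f i S) :
    1 < S.card := by
  by_contra hc
  exact h.2 0 hi (not_lt.mp hc)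

theorem SyncAt.levelsUpTo {k L : ℕ} {S : Finset (Fin n)} (hS : S.card ≤ k) (h : SyncAt f L S) :
    LevelsUpTo f k L := by
  induction L generalizing S with
  | zero => intro i h1 h2; omega
  | succ L ih =>
    intro i h1 h2
    rcases Nat.lt_or_ge L i with hi | hi
    · obtain rfl : i = L + 1 := by omega
      exact ⟨S, hS, h⟩
    · obtain ⟨a, ha⟩ := h.exists_image
      exact ih (Finset.card_image_le.trans hS) ha i h1 hi

theorem LevelsUpTo.mono {k L L' : ℕ} (hL : L' ≤ L) (h : LevelsUpTo f k L) : LevelsUpTo f k L' :=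
  fun i h1 h2 => h i h1 (h2.trans hL)

/-- Only the top level can be attained by the full state set alone. -/
theorem LevelsUpTo.pred {k L : ℕ} (hn : n = k + 1) (h : LevelsUpTo f n (L + 1)) :
    LevelsUpTo f k L := by
  intro i h1 h2
  obtain ⟨S, -, hS⟩ := h i h1 (by omega)
  rcases Nat.lt_or_ge k S.card with hc | hc
  · have hu : S = Finset.univ := by
      rw [← Finset.card_eq_iff_eq_univ, Fintype.card_fin]
      have := Finset.card_le_univ S
      rw [Fintype.card_fin] at this
      omega
    obtain ⟨T, -, hT⟩ := h (i + 1) (by omega) (by omega)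
    exact absurd (hS.1.anti (hu ▸ Finset.subset_univ T)) (hT.2 i (Nat.lt_succ_self i))
  · exact ⟨S, hc, hS⟩

theorem LevelsUpTo.le_of_forall {k L m : ℕ} (h : LevelsUpTo f k L)
    (hm : ∀ S : Finset (Fin n), S.card ≤ k → SyncIn f m S) : L ≤ m := by
  by_contra hc
  obtain ⟨S, hS, hE⟩ := h L (by omega) le_rfl
  exact hE.2 m (by omega) (hm S hS)

/-- If the levels `j + 1, …, L` are all met inside a family, the family has at least `L - j`
members. -/
theorem le_add_card_of_levels {j L : ℕ} (F : Finset (Finset (Fin n)))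
    (h : ∀ i, j < i → i ≤ L → ∃ S ∈ F, SyncAt f i S) : L ≤ j + F.card := by
  classical
  have h' : ∀ i : ℕ, ∃ S, i ∈ Finset.Ioc j L → S ∈ F ∧ SyncAt f i S := by
    intro i
    by_cases hi : i ∈ Finset.Ioc j L
    · obtain ⟨S, hS⟩ := h i (Finset.mem_Ioc.1 hi).1 (Finset.mem_Ioc.1 hi).2
      exact ⟨S, fun _ => hS⟩
    · exact ⟨∅, fun hi' => absurd hi' hi⟩
  choose g hg using h'
  have := Finset.card_le_card_of_injOn (s := Finset.Ioc j L) (t := F) g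
    (fun i hi => (hg i hi).1)
    (fun i hi i' hi' he => (hg i hi).2.unique (he ▸ (hg i' hi').2))
  rw [Nat.card_Ioc] at this
  omega

open Classical in
/-- The pairs of states that no word of length at most `j` merges. -/
noncomputable def openPairs (f : α → Fin n → Fin n) (j : ℕ) : Finset (Finset (Fin n)) :=
  Finset.univ.filter fun P => P.card = 2 ∧ ¬ SyncIn f j P

theorem mem_openPairs {j : ℕ} {P : Finset (Fin n)} :
    P ∈ openPairs f j ↔ P.card = 2 ∧ ¬ SyncIn f j P := by
  simp [openPairs]

theorem card_openPairs_le (j : ℕ) : (openPairs f j).card ≤ n.choose 2 := by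
  have : openPairs f j ⊆ Finset.powersetCard 2 Finset.univ := fun P hP =>
    Finset.mem_powersetCard.2 ⟨Finset.subset_univ _, (mem_openPairs.1 hP).1⟩
  simpa using Finset.card_le_card this

theorem exists_pair_subset {S : Finset (Fin n)} (h : 1 < S.card) : ∃ P ⊆ S, P.card = 2 :=
  Finset.exists_subset_card_eq h

/-- If every pair can be merged, then all pairs are merged by words of length at most
`j + (openPairs f j).card`. -/
theorem syncIn_of_pairs (hp : ∀ P : Finset (Fin n), P.card = 2 → ∃ i, SyncIn f i P) (j : ℕ)
    {P : Finset (Fin n)} (hP : P.card ≤ 2) : SyncIn f (j + (openPairs f j).card) P := by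
  rcases Nat.lt_or_ge P.card 2 with h1 | h2
  · exact syncIn_of_card_le_one (by omega) _
  obtain ⟨i, hi⟩ := hp P (by omega)
  obtain ⟨L, -, hL⟩ := hi.exists_syncAt
  have hK := hL.levelsUpTo hP
  refine hL.1.mono (le_add_card_of_levels (f := f) (openPairs f j) fun i h1 h2 => ?_)
  obtain ⟨S, hS, hSi⟩ := hK i (by omega) h2
  have := hSi.one_lt_card (by omega)
  exact ⟨S, mem_openPairs.2 ⟨by omega, hSi.2 j h1⟩, hSi⟩

/-- Merging a pair inside `T` first and synchronizing the smaller image afterwards. -/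
theorem syncIn_of_hit {k m : ℕ} (hm : ∀ S : Finset (Fin n), S.card < k → SyncIn f m S)
    {c : ℕ} {P T : Finset (Fin n)} (hPT : P ⊆ T) (hP : 1 < P.card) (hT : T.card ≤ k)
    (h : SyncIn f c P) : SyncIn f (c + m) T := by
  induction c generalizing P T with
  | zero => exact absurd h (not_le.mpr hP)
  | succ c ih =>
    rcases h with h | ⟨a, h⟩
    · exact (ih hPT hP hT h).mono (by omega)
    · have himg : P.image (f a) ⊆ T.image (f a) := Finset.image_subset_image hPT
      rcases Nat.lt_or_ge 1 (P.image (f a)).card with hc | hc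
      · have := ih himg hc (Finset.card_image_le.trans hT) h
        exact SyncIn.mono (by omega) (show SyncIn f (c + m + 1) T from Or.inr ⟨a, this⟩)
      · have hlt : (T.image (f a)).card < T.card := by
          refine lt_of_le_of_ne Finset.card_image_le fun he => ?_
          have hinj := (Finset.card_image_iff.1 he).mono (Finset.coe_subset.2 hPT)
          rw [Finset.card_image_of_injOn hinj] at hc
          omega
        have := hm _ (hlt.trans_le hT)
        exact SyncIn.mono (by omega) (show SyncIn f (m + 1) T from Or.inr ⟨a, this⟩)

theorem exists_syncIn_of_pairs (hp : ∀ P : Finset (Fin n), P.card = 2 → ∃ i, SyncIn f i P)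
    (S : Finset (Fin n)) : ∃ i, SyncIn f i S := by
  suffices h : ∀ k, ∃ m, ∀ S : Finset (Fin n), S.card < k → SyncIn f m S by
    obtain ⟨m, hm⟩ := h (S.card + 1)
    exact ⟨m, hm S (Nat.lt_succ_self _)⟩
  intro k
  induction k with
  | zero => exact ⟨0, fun S hS => absurd hS (Nat.not_lt_zero _)⟩
  | succ k ih =>
    obtain ⟨m, hm⟩ := ih
    refine ⟨(0 + (openPairs f 0).card) + m, fun S hS => ?_⟩
    rcases Nat.lt_or_ge 1 S.card with h1 | h1
    · obtain ⟨P, hPS, hP⟩ := exists_pair_subset h1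
      exact syncIn_of_hit hm hPS (by omega) (by omega) (syncIn_of_pairs hp 0 hP.le)
    · exact syncIn_of_card_le_one h1 _

/-- Every set of `r` states contains a pair merged by a word of length at most `c`. -/
def HitWithin (f : α → Fin n → Fin n) (r c : ℕ) : Prop :=
  ∀ T : Finset (Fin n), T.card = r → ∃ P ⊆ T, P.card = 2 ∧ SyncIn f c P

theorem hitWithin_of_pairs {r c : ℕ} (hr : 2 ≤ r)
    (h : ∀ P : Finset (Fin n), P.card = 2 → SyncIn f c P) : HitWithin f r c := fun T hT => by
  obtain ⟨P, hPT, hP⟩ := exists_pair_subset (S := T) (by omega)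
  exact ⟨P, hPT, hP, h P hP⟩

theorem HitWithin.syncIn {r c m : ℕ} (h : HitWithin f r c)
    (hm : ∀ S : Finset (Fin n), S.card < r → SyncIn f m S) {T : Finset (Fin n)}
    (hT : T.card ≤ r) : SyncIn f (c + m) T := by
  rcases hT.lt_or_eq with hT | hT
  · exact (hm T hT).mono (by omega)
  · obtain ⟨P, hPT, hP, hc⟩ := h T hT
    exact syncIn_of_hit hm hPT (by omega) hT.le hc

theorem LevelsUpTo.le_of_hitWithin_three {c L : ℕ}
    (hp : ∀ P : Finset (Fin n), P.card = 2 → ∃ i, SyncIn f i P) (h3 : HitWithin f 3 c)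
    (h : LevelsUpTo f 3 L) (j : ℕ) : L ≤ c + (j + (openPairs f j).card) :=
  h.le_of_forall fun _ hS => h3.syncIn (fun _ hT => syncIn_of_pairs hp j (by omega)) hS

theorem LevelsUpTo.le_of_hitWithin_four {c c' L : ℕ}
    (hp : ∀ P : Finset (Fin n), P.card = 2 → ∃ i, SyncIn f i P) (h3 : HitWithin f 3 c)
    (h4 : HitWithin f 4 c') (h : LevelsUpTo f 4 L) (j : ℕ) :
    L ≤ c' + (c + (j + (openPairs f j).card)) :=
  h.le_of_forall fun _ hS => h4.syncIn (fun _ hT => h3.syncIn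
    (fun _ hU => syncIn_of_pairs hp j (by omega)) (by omega)) hS

/-- Counting the sets that can occur at the levels above `j`, when the pairs in `N` and the sets of
more than two states outside `B` can never be synchronized. -/
theorem LevelsUpTo.le_of_card {k L : ℕ} (N B : Finset (Finset (Fin n)))
    (hN : ∀ P ∈ N, P.card = 2 ∧ ∀ i, ¬ SyncIn f i P)
    (hB : ∀ S : Finset (Fin n), 2 < S.card → S.card ≤ k → (∃ i, SyncIn f i S) → S ∈ B)
    (h : LevelsUpTo f k L) (j : ℕ) : L + N.card ≤ j + (openPairs f j).card + B.card := by
  classical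
  have hsub : N ⊆ openPairs f j := fun P hP => mem_openPairs.2 ⟨(hN P hP).1, (hN P hP).2 j⟩
  have := le_add_card_of_levels (f := f) (j := j) (L := L) ((openPairs f j \ N) ∪ B)
    fun i h1 h2 => by
      obtain ⟨S, hS, hSi⟩ := h i (by omega) h2
      have h2 := hSi.one_lt_card (by omega)
      refine ⟨S, ?_, hSi⟩
      rcases Nat.lt_or_ge 2 S.card with h3 | h3
      · exact Finset.mem_union_right _ (hB S h3 hS ⟨i, hSi.1⟩)
      · refine Finset.mem_union_left _ (Finset.mem_sdiff.2 ⟨mem_openPairs.2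
          ⟨by omega, hSi.2 j h1⟩, fun hSN => (hN S hSN).2 i hSi.1⟩)
  have h1 := Finset.card_union_le (openPairs f j \ N) B
  have h2 := Finset.card_sdiff_add_card_eq_card hsub
  omega

/-- Relabelling the states. -/
theorem syncIn_conj (σ : Equiv.Perm (Fin n)) {i : ℕ} {S : Finset (Fin n)} :
    SyncIn (fun a p => σ.symm (f a (σ p))) i S ↔ SyncIn f i (S.image σ) := by
  induction i generalizing S with
  | zero => simp [SyncIn, Finset.card_image_of_injective _ σ.injective]
  | succ i ih =>
    simp only [SyncIn, ih, Finset.image_image]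
    have : ∀ a, S.image (σ ∘ fun p => σ.symm (f a (σ p))) = S.image (f a ∘ σ) := fun a => by
      congr 1; ext p; simp
    simp only [this]

theorem syncAt_conj (σ : Equiv.Perm (Fin n)) {i : ℕ} {S : Finset (Fin n)} :
    SyncAt (fun a p => σ.symm (f a (σ p))) i S ↔ SyncAt f i (S.image σ) := by
  simp only [SyncAt, syncIn_conj]

theorem levelsUpTo_conj (σ : Equiv.Perm (Fin n)) {k L : ℕ} (h : LevelsUpTo f k L) :
    LevelsUpTo (fun a p => σ.symm (f a (σ p))) k L := fun i h1 h2 => by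
  obtain ⟨S, hS, hSi⟩ := h i h1 h2
  refine ⟨S.image σ.symm, Finset.card_image_le.trans hS, (syncAt_conj σ).2 ?_⟩
  simpa [Finset.image_image] using hSi

end Levels

/-- `force x f = f x`; in kernel reduction `x` is evaluated to a literal before `f` is applied. -/
def force {β : Type} (x : ℕ) (f : ℕ → β) : β :=
  Nat.rec (motive := fun _ => β) (f 0) (fun k _ => f k) (Nat.add x 1)

/-- `sel b x y` is `x` if `b` holds and `y` otherwise, evaluated lazily. -/
def sel {β : Type} (b : Bool) (x y : β) : β := Bool.rec (motive := fun _ => β) y x b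

/-- Evaluate the spine of a list before passing it on. -/
def forceSpine {α β : Type} (l : List α) : (List α → β) → β :=
  List.rec (motive := fun _ => (List α → β) → β) (fun k => k [])
    (fun x _ ih k => ih fun t => k (x :: t)) l

def concatBlocks (len : ℕ) (g : ℕ → ℕ) : ℕ → ℕ
  | 0 => 0
  | k + 1 => Nat.lor (concatBlocks len g k) (Nat.shiftLeft (g k) (Nat.mul k len))

def preMask (n b p : ℕ) : ℕ :=
  force (Nat.pow n p) fun l =>
  force (concatBlocks l (fun x => bif Nat.testBit b x then Nat.sub (Nat.pow 2 l) 1 else 0) n) fun m =>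
  concatBlocks (Nat.mul l n) (fun _ => m) (Nat.pow n (Nat.sub n (Nat.add p 1)))

/-- Scramble the low 64 bits, which the kernel uses as the hash of a literal. -/
def scramble (x : ℕ) : ℕ := Nat.xor x (Nat.mod x 18446744073709551557)

structure Item where
  id : ℕ
  act : ℕ → ℕ → ℕ → ℕ → ℕ → ℕ → ℕ
  pre : (ℕ → ℕ → ℕ → ℕ → ℕ → ℕ) → ℕ
  lvl : ℕ

def cand (act : ℕ → ℕ → ℕ → ℕ → ℕ → ℕ) (L : List Item) : ℕ :=
  List.rec (motive := fun _ => ℕ) 0 (fun B _ ih => Nat.lor (B.pre act) ih) L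

def feasible (W : ℕ) (l : List ℕ) : Bool :=
  List.rec (motive := fun _ => Bool) true
    (fun r _ ih => sel (Nat.ble (Nat.land r W) 18446744073709551615) false ih) l

/-- The continuation type of the search: kept items, added items, allowed letters, required letter
sets, number of items not yet added. -/
def SearchCont := List Item → List Item → ℕ → List ℕ → ℕ → Bool

def goOut' (A : Item) (ih : SearchCont) (kept added : List Item) (req : List ℕ) (s W : ℕ) :
    Bool :=
  sel (feasible W req) (ih (A :: kept) added W req s) true

def goOut (A : Item) (ih : SearchCont) (kept added : List Item) (W : ℕ) (req : List ℕ)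
    (s c : ℕ) : Bool :=
  force (Nat.xor W c) (goOut' A ih kept added req s)

def goIn' (ok : ℕ → Bool) (A : Item) (ih : SearchCont) (kept added : List Item) (W : ℕ)
    (req : List ℕ) (c s : ℕ) : Bool :=
  sel (ok s) (ih kept (A :: added) W (c :: req) s) true

def goIn (ok : ℕ → Bool) (A : Item) (ih : SearchCont) (kept added : List Item) (W : ℕ)
    (req : List ℕ) (s c : ℕ) : Bool :=
  force (Nat.sub s 1) (goIn' ok A ih kept added W req c)

def goBoth (ok : ℕ → Bool) (A : Item) (ih : SearchCont) (kept added : List Item) (W : ℕ)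
    (req : List ℕ) (s c : ℕ) : Bool :=
  sel (goOut A ih kept added W req s c) (goIn ok A ih kept added W req s c) false

def goStep (next : ℕ) (ok : ℕ → Bool) (A : Item) (ih : SearchCont) (kept added : List Item) (W : ℕ)
    (req : List ℕ) (s c : ℕ) : Bool :=
  sel (Nat.beq A.lvl 0)
    (sel (Nat.ble c 18446744073709551615) (ih (A :: kept) added W req s)
      (force (scramble c) (goBoth ok A ih kept added W req s)))
    (sel (Nat.beq A.lvl next)
      (sel (Nat.ble c 18446744073709551615) true
        (force (scramble c) (goIn ok A ih kept added W req s)))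
      (sel (Nat.ble c 18446744073709551615) (ih (A :: kept) added W req s)
        (force (scramble c) (goOut A ih kept added W req s))))

def go (next : ℕ) (layer : List Item) (ok : ℕ → Bool) (K : SearchCont) (todo : List Item) :
    SearchCont :=
  List.rec (motive := fun _ => SearchCont) K
    (fun A _ ih kept added W req s =>
      force (cand (A.act W) layer) (goStep next ok A ih kept added W req s)) todo


def bigLevel : ℕ → List (List Item) → List Item → List Item → ℕ → List ℕ → ℕ → Bool
  | 0, _, _, _, _, _, _ => false
  | f + 1, ext, rem, added, W, req, s =>
    sel (Nat.ble (Nat.add ext.tail.length s) f) true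
    (forceSpine (added ++ ext.headD []) fun layer =>
     forceSpine ext.tail fun ext' =>
     go 1 layer (fun _ => true) (fun kept added W req s =>
      sel (added.isEmpty && ext'.isEmpty) true (bigLevel f ext' kept added W req s))
      rem [] [] W req s)

def idMask : List Item → ℕ
  | [] => 0
  | A :: l => Nat.lor (Nat.shiftLeft 1 A.id) (idMask l)

def allHit (m : ℕ) : List ℕ → Bool
  | [] => true
  | t :: l => sel (Nat.beq (Nat.land t m) t) false (allHit m l)

structure Params where
  th3 : ℕ
  th4 : ℕ
  minTot : ℕ
  tri : List ℕ
  quad : List ℕ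

def pairLevel (P : Params) (leaf : List Item → List (List Item) → ℕ → List ℕ → Bool) :
    ℕ → ℕ → List Item → List Item → List (List Item) → ℕ → List ℕ → ℕ → ℕ → ℕ → Bool
  | 0, _, _, _, _, _, _, _, _, _ => false
  | f + 1, lev, rem, layer, hist, W, req, s, c3, c4 =>
    force (idMask rem) fun m =>
    force (sel (Nat.beq c3 0 && allHit m P.tri) lev c3) fun c3 =>
    force (sel (Nat.beq c4 0 && allHit m P.quad) lev c4) fun c4 =>
    sel (!(Nat.beq c3 0) && !(Nat.beq c4 0) && !(Nat.ble P.th3 (Nat.add lev (Nat.add s c3)))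
      && !(Nat.ble P.th4 (Nat.add lev (Nat.add s (Nat.add c3 c4))))) true
    (force (Nat.add lev 1) fun lev' =>
    forceSpine hist fun hist =>
    go lev' layer (fun s => Nat.ble P.minTot (Nat.add s lev')) (fun kept added W req s =>
      sel added.isEmpty (leaf kept hist W req)
        (pairLevel P leaf f lev' kept added (hist ++ [added]) W req s c3 c4)) rem [] [] W req s)

def freeItem (kept : List Item) : Bool := kept.any fun A => Nat.beq A.lvl 0

def withItems {β : Type} (n : ℕ) :
    List (ℕ × (ℕ → ℕ → ℕ → ℕ → ℕ → ℕ → ℕ) × ℕ) → (List Item → β) → β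
  | [], k => k []
  | (b, m, l) :: r, k =>
    force (scramble (Nat.shiftLeft (preMask n b 0) 64)) fun m0 =>
    force (scramble (Nat.shiftLeft (preMask n b 1) 64)) fun m1 =>
    force (scramble (Nat.shiftLeft (preMask n b 2) 64)) fun m2 =>
    force (scramble (Nat.shiftLeft (preMask n b 3) 64)) fun m3 =>
    force (scramble (Nat.shiftLeft (preMask n b 4) 64)) fun m4 =>
    withItems n r fun t => k (⟨b, m, fun k => k m0 m1 m2 m3 m4, l⟩ :: t)

theorem force_eq {β : Type} (x : ℕ) (f : ℕ → β) : force x f = f x := by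
  cases x <;> rfl

theorem sel_eq {β : Type} (b : Bool) (x y : β) : sel b x y = bif b then x else y := by
  cases b <;> rfl

theorem forceSpine_eq {α β : Type} (l : List α) (k : List α → β) : forceSpine l k = k l := by
  induction l generalizing k with
  | nil => rfl
  | cons x t ih => exact ih fun t => k (x :: t)

theorem lt_two_pow_of_concatBlocks (len : ℕ) (g : ℕ → ℕ) (hg : ∀ x, g x < 2 ^ len) (k : ℕ) :
    concatBlocks len g k < 2 ^ (k * len) := by
  induction k with
  | zero => simp [concatBlocks]
  | succ k ih =>
    refine Nat.or_lt_two_pow (ih.trans_le (Nat.pow_le_pow_right two_pos (by gcongr; omega))) ?_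
    change g k <<< (k * len) < _
    rw [Nat.shiftLeft_eq, add_mul, one_mul, pow_add, mul_comm]
    exact Nat.mul_lt_mul_of_pos_left (hg k) (by positivity)

theorem testBit_concatBlocks (len : ℕ) (hlen : 0 < len) (g : ℕ → ℕ) (hg : ∀ x, g x < 2 ^ len)
    (k c : ℕ) : (concatBlocks len g k).testBit c =
      (decide (c / len < k) && (g (c / len)).testBit (c % len)) := by
  induction k with
  | zero => simp [concatBlocks]
  | succ k ih =>
    change (concatBlocks len g k ||| g k <<< (k * len)).testBit c = _
    rw [Nat.testBit_or, ih, Nat.testBit_shiftLeft]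
    rcases lt_trichotomy (c / len) k with h | h | h
    · have : ¬ k * len ≤ c := by
        rw [not_le]; exact (Nat.div_lt_iff_lt_mul hlen).1 h
      simp [h, this, Nat.lt_succ_of_lt h]
    · subst h
      have hm : c - c / len * len = c % len := by
        have := Nat.div_add_mod' c len; omega
      have hle : c / len * len ≤ c := Nat.div_mul_le_self c len
      simp [hm, hle]
    · have hle : (k + 1) * len ≤ c := (Nat.le_div_iff_mul_le hlen).1 h
      have : (g k).testBit (c - k * len) = false := by
        refine Nat.testBit_lt_two_pow ((hg k).trans_le (Nat.pow_le_pow_right two_pos ?_))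
        rw [add_mul] at hle; omega
      simp [this, show ¬ c / len < k by omega, show ¬ c / len < k + 1 by omega]

theorem testBit_preMask {n b p c : ℕ} (hp : p < n) (hc : c < n ^ n) :
    (preMask n b p).testBit c = b.testBit (c / n ^ p % n) := by
  have hn : 0 < n := by omega
  set g : ℕ → ℕ := fun x => bif Nat.testBit b x then 2 ^ (n ^ p) - 1 else 0 with hgdef
  have hg : ∀ x, g x < 2 ^ (n ^ p) := fun x => by
    have : 0 < 2 ^ (n ^ p) := by positivity
    simp only [hgdef]
    cases Nat.testBit b x <;> simp
  have hm := lt_two_pow_of_concatBlocks (n ^ p) g hg n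
  change (concatBlocks (n ^ p * n) (fun _ => concatBlocks (n ^ p) g n)
    (n ^ (n - (p + 1)))).testBit c = _
  rw [testBit_concatBlocks _ (by positivity) _ (fun _ => by rwa [mul_comm] at hm),
    testBit_concatBlocks _ (by positivity) _ hg]
  have h1 : c / (n ^ p * n) < n ^ (n - (p + 1)) := by
    rw [Nat.div_lt_iff_lt_mul (by positivity), ← pow_succ, ← pow_add]
    rwa [Nat.sub_add_cancel (by omega)]
  have h2 : c % (n ^ p * n) / n ^ p = c / n ^ p % n := Nat.mod_mul_right_div_self ..
  have h3 : c % (n ^ p * n) % n ^ p = c % n ^ p := Nat.mod_mul_right_mod ..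
  rw [h2, h3]
  have h4 : c / n ^ p % n < n := Nat.mod_lt _ hn
  have h5 : c % n ^ p < n ^ p := Nat.mod_lt _ (by positivity)
  simp only [h1, h4, decide_true, Bool.true_and, hgdef]
  cases b.testBit (c / n ^ p % n) <;> simp [Nat.testBit_two_pow_sub_one, h5]

theorem testBit_scramble {x c : ℕ} (hc : 64 ≤ c) : (scramble x).testBit c = x.testBit c := by
  change (x ^^^ x % 18446744073709551557).testBit c = _
  have : (x % 18446744073709551557).testBit c = false := by
    refine Nat.testBit_lt_two_pow (lt_of_lt_of_le ?_ (Nat.pow_le_pow_right two_pos hc))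
    exact (Nat.mod_lt _ (by norm_num)).trans (by norm_num)
  simp [Nat.testBit_xor, this]

theorem not_ble_of_testBit {x c : ℕ} (hc : 64 ≤ c) (h : x.testBit c = true) :
    Nat.ble x 18446744073709551615 = false := by
  rw [← Bool.not_eq_true, Nat.ble_eq, not_le]
  by_contra hx
  rw [Nat.testBit_lt_two_pow (lt_of_lt_of_le (show x < 2 ^ 64 by omega)
    (Nat.pow_le_pow_right two_pos hc))] at h
  exact Bool.noConfusion h

/-- The set of states encoded by the binary digits of `b`. -/
def bitSet (n b : ℕ) : Finset (Fin n) := Finset.univ.filter fun p => b.testBit p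

section Soundness

variable {n : ℕ} {α : Type} (f : α → Fin n → Fin n)

/-- The position of the letter `a` in the masks. -/
def letterBit (a : α) : ℕ := finFunctionFinEquiv (f a) + 64

/-- The letter `a` belongs to the letter set encoded by `W`. -/
def HasLetter (W : ℕ) (a : α) : Prop := W.testBit (letterBit f a) = true

def Item.set (n : ℕ) (A : Item) : Finset (Fin n) := bitSet n A.id

/-- The masks stored in an item agree with the set it stands for. -/
def Item.Valid (A : Item) : Prop :=
  A.id < 2 ^ n ∧ ∃ M : ℕ → ℕ, (∀ k, A.pre k = k (M 0) (M 1) (M 2) (M 3) (M 4)) ∧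
    (∀ a, ∀ p : Fin n, HasLetter f (M p) a ↔ f a p ∈ A.set n) ∧
    ∀ W (M' : ℕ → ℕ) c, (A.act W (M' 0) (M' 1) (M' 2) (M' 3) (M' 4)).testBit c = true ↔
      W.testBit c = true ∧ ∀ p : Fin n, p ∈ A.set n → (M' p).testBit c = true

variable {f}

theorem hasLetter_preMask (b : ℕ) (a : α) (p : Fin n) :
    HasLetter f (scramble (Nat.shiftLeft (preMask n b p) 64)) a ↔ f a p ∈ bitSet n b := by
  unfold HasLetter letterBit
  rw [testBit_scramble (show 64 ≤ _ + 64 from Nat.le_add_left _ _)]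
  change (preMask n b p <<< 64).testBit _ = true ↔ _
  rw [Nat.testBit_shiftLeft]
  have hc : (finFunctionFinEquiv (f a) : ℕ) < n ^ n := (finFunctionFinEquiv (f a)).isLt
  have hd : (finFunctionFinEquiv (f a) : ℕ) / n ^ (p : ℕ) % n = f a p := by
    have := congrArg (fun g : Fin n → Fin n => (g p : ℕ))
      (finFunctionFinEquiv.symm_apply_apply (f a))
    rwa [finFunctionFinEquiv_symm_apply_val] at this
  simp only [ge_iff_le, Nat.le_add_left, decide_true, Bool.true_and, Nat.add_sub_cancel,
    testBit_preMask p.isLt hc, hd]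
  simp [bitSet]

theorem hasLetter_cand {A : Item} {layer : List Item} (hA : A.Valid f)
    (hL : ∀ B ∈ layer, B.Valid f) (W : ℕ) (a : α) :
    HasLetter f (cand (A.act W) layer) a ↔
      HasLetter f W a ∧ ∃ B ∈ layer, (A.set n).image (f a) ⊆ B.set n := by
  induction layer with
  | nil => simp [cand, HasLetter]
  | cons B L ih =>
    have h1 : HasLetter f (B.pre (A.act W)) a ↔
        HasLetter f W a ∧ (A.set n).image (f a) ⊆ B.set n := by
      obtain ⟨-, -, -, -, hact⟩ := hA
      obtain ⟨-, M, hpre, hM, -⟩ := hL B (by simp)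
      unfold HasLetter
      rw [hpre, hact]
      simp only [Finset.image_subset_iff]
      exact and_congr_right fun _ => forall₂_congr fun p _ => hM a p
    have h2 : HasLetter f (cand (A.act W) (B :: L)) a ↔
        HasLetter f (B.pre (A.act W)) a ∨ HasLetter f (cand (A.act W) L) a := by
      unfold HasLetter
      change (B.pre (A.act W) ||| cand (A.act W) L).testBit _ = true ↔ _
      simp [Nat.testBit_or]
    rw [h2, h1, ih fun C hC => hL C (List.mem_cons_of_mem _ hC)]
    simp only [List.mem_cons, exists_eq_or_imp]
    tauto

theorem hasLetter_scramble {W : ℕ} {a : α} : HasLetter f (scramble W) a ↔ HasLetter f W a := by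
  unfold HasLetter
  rw [testBit_scramble (show 64 ≤ letterBit f a from Nat.le_add_left _ _)]

theorem HasLetter.not_ble {W : ℕ} {a : α} (h : HasLetter f W a) :
    Nat.ble W 18446744073709551615 = false :=
  not_ble_of_testBit (Nat.le_add_left _ _) h

variable (f) in
/-- `W` contains all letters, and every set in `req` contains a letter. -/
def MasksOK (W : ℕ) (req : List ℕ) : Prop :=
  (∀ a, HasLetter f W a) ∧ ∀ r ∈ req, ∃ a, HasLetter f r a

theorem MasksOK.feasible {W : ℕ} {req : List ℕ} (h : MasksOK f W req) : feasible W req = true := by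
  induction req with
  | nil => rfl
  | cons r t ih =>
    obtain ⟨a, ha⟩ := h.2 r (by simp)
    have hb : HasLetter f (Nat.land r W) a := by
      change (r &&& W).testBit _ = true
      rw [Nat.testBit_and, Bool.and_eq_true]
      exact ⟨ha, h.1 a⟩
    change sel (Nat.ble (Nat.land r W) 18446744073709551615) false (_root_.feasible W t) = true
    rw [sel_eq, hb.not_ble]
    exact ih ⟨h.1, fun r hr => h.2 r (List.mem_cons_of_mem _ hr)⟩

open Classical in
/-- One pass of the search reaches the branch described by the automaton. -/
theorem go_sound {i next : ℕ} (hnext : next ≠ 0) {layer : List Item} {ok : ℕ → Bool}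
    {K : SearchCont} (hL : ∀ B ∈ layer, B.Valid f ∧ SyncIn f i (B.set n)) (todo : List Item)
    (hA : ∀ A ∈ todo, A.Valid f ∧ ¬ SyncIn f i (A.set n) ∧
      (∀ a, SyncIn f i ((A.set n).image (f a)) → ∃ B ∈ layer, (A.set n).image (f a) ⊆ B.set n) ∧
      (A.lvl ≠ 0 → (SyncIn f (i + 1) (A.set n) ↔ A.lvl = next)))
    (kept added : List Item) (W : ℕ) (req : List ℕ) (s : ℕ)
    (hs : s = todo.length + kept.length)
    (hok : ∀ t, ((todo.filter fun A => ¬ SyncIn f (i + 1) (A.set n)).reverse ++ kept).length ≤ t →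
      ok t = true)
    (hW : MasksOK f W req) (h : go next layer ok K todo kept added W req s = true) :
    ∃ W' req', MasksOK f W' req' ∧
      K ((todo.filter fun A => ¬ SyncIn f (i + 1) (A.set n)).reverse ++ kept)
        ((todo.filter fun A => SyncIn f (i + 1) (A.set n)).reverse ++ added) W' req'
        ((todo.filter fun A => ¬ SyncIn f (i + 1) (A.set n)).reverse ++ kept).length = true := by
  induction todo generalizing kept added W req s with
  | nil =>
    refine ⟨W, req, hW, ?_⟩
    have : s = kept.length := by simpa using hs
    subst this
    exact h
  | cons A t ih =>
    obtain ⟨hval, hn, hcomp, hlvl⟩ := hA A (by simp)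
    have ih := ih fun B hB => hA B (List.mem_cons_of_mem _ hB)
    have hcand := hasLetter_cand hval (fun B hB => (hL B hB).1) W
    set c := cand (A.act W) layer with hc
    have hiff : ∀ a, HasLetter f c a ↔ SyncIn f i ((A.set n).image (f a)) := fun a => by
      rw [hcand]
      exact ⟨fun ⟨_, B, hB, hs⟩ => (hL B hB).2.anti hs, fun hs => ⟨hW.1 a, hcomp a hs⟩⟩
    have hsucc : SyncIn f (i + 1) (A.set n) ↔ ∃ a, HasLetter f c a := by
      simp only [hiff]
      exact ⟨fun h => h.resolve_left hn, Or.inr⟩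
    change goStep next ok A (go next layer ok K t) kept added W req s c = true at h
    simp only [goStep, sel_eq, force_eq, goBoth] at h
    by_cases hin : SyncIn f (i + 1) (A.set n)
    · obtain ⟨a, ha⟩ := hsucc.1 hin
      have hI : goIn ok A (go next layer ok K t) kept added W req s (scramble c) = true := by
        rw [ha.not_ble] at h
        by_cases h0 : A.lvl = 0
        · rw [h0] at h
          simp only [Nat.beq_refl, cond_true, cond_false] at h
          revert h
          cases goOut A (go next layer ok K t) kept added W req s (scramble c) <;> simp
        · have h1 := (hlvl h0).1 hin
          have h2 : Nat.beq next 0 = false := by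
            rw [← Bool.not_eq_true, Nat.beq_eq]; exact hnext
          simpa [h1, h2] using h
      simp only [List.filter_cons, hin, not_true_eq_false, decide_true, decide_false, if_true,
        Bool.false_eq_true, if_false, List.reverse_cons, List.append_assoc,
        List.singleton_append] at hok ⊢
      simp only [goIn, goIn', force_eq, sel_eq] at hI
      have hs' : Nat.sub s 1 = t.length + kept.length := by
        change s - 1 = _
        rw [hs, List.length_cons]; omega
      rw [hok _ (by
        rw [hs']
        have := List.length_filter_le (fun A => decide (¬ SyncIn f (i + 1) (Item.set n A))) t
        simp only [List.length_append, List.length_reverse]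
        omega)] at hI
      refine ih kept (A :: added) W (scramble c :: req) _ hs' hok ⟨hW.1, ?_⟩ hI
      intro r hr
      rcases List.mem_cons.1 hr with rfl | hr
      · exact ⟨a, hasLetter_scramble.2 ha⟩
      · exact hW.2 r hr
    · have hno : ∀ a, ¬ HasLetter f c a := fun a ha => hin (hsucc.2 ⟨a, ha⟩)
      have hlen : s = t.length + (A :: kept).length := by
        rw [hs, List.length_cons, List.length_cons]; omega
      simp only [List.filter_cons, hin, not_false_eq_true, decide_true, decide_false, if_true,
        Bool.false_eq_true, if_false, List.reverse_cons, List.append_assoc,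
        List.singleton_append] at hok ⊢
      have hnn : Nat.beq A.lvl next = false := by
        rw [← Bool.not_eq_true, Nat.beq_eq]
        intro he
        exact hin ((hlvl (he ▸ hnext)).2 he)
      rw [hnn] at h
      have hO : go next layer ok K t (A :: kept) added W req s = true ∨
          goOut A (go next layer ok K t) kept added W req s (scramble c) = true := by
        revert h
        cases Nat.beq A.lvl 0 <;> cases Nat.ble c 18446744073709551615 <;>
          cases goOut A (go next layer ok K t) kept added W req s (scramble c) <;> simp
      rcases hO with hO | hO
      · exact ih (A :: kept) added W req s hlen hok hW hO
      · have hW' : MasksOK f (Nat.xor W (scramble c)) req := by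
          refine ⟨fun a => ?_, hW.2⟩
          have h1 := hW.1 a
          have h2 : (scramble c).testBit (letterBit f a) = false := by
            rw [← Bool.not_eq_true]
            exact fun h => hno a (hasLetter_scramble.1 h)
          change (W ^^^ scramble c).testBit _ = true
          rw [Nat.testBit_xor, h2, h1]
          rfl
        simp only [goOut, goOut', force_eq, sel_eq, hW'.feasible, cond_true] at hO
        exact ih (A :: kept) added _ req s hlen hok hW' hO

end Soundness

section Levelwise

variable {n : ℕ} {α : Type} (f : α → Fin n → Fin n)

/-- The items of `layer` are synchronized by words of length `j`, and they cover all sets of at most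
two states whose shortest synchronizing word has length `j`. -/
def LayerOK (j : ℕ) (layer : List Item) : Prop :=
  (∀ B ∈ layer, B.Valid f ∧ SyncIn f j (B.set n)) ∧
    ∀ S : Finset (Fin n), S.card ≤ 2 → SyncAt f j S → ∃ B ∈ layer, S ⊆ B.set n

variable {f}

theorem bigLevel_ne_true {k : ℕ} (F lev : ℕ) (hF : LevelsUpTo f k (lev + F))
    (ext : List (List Item)) (rem added : List Item) (W : ℕ) (req : List ℕ)
    (hext : ∀ j, LayerOK f (lev + j) (ext.getD j []))
    (hrem : ∀ A ∈ rem, A.Valid f ∧ (A.set n).card ≤ k ∧ A.lvl = 0 ∧ ¬ SyncIn f lev (A.set n))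
    (hrem' : ∀ S : Finset (Fin n), 2 < S.card → S.card ≤ k → (∃ i, SyncIn f i S) →
      ¬ SyncIn f lev S → ∃ A ∈ rem, A.set n = S)
    (hadd : ∀ A ∈ added, A.Valid f ∧ SyncIn f lev (A.set n))
    (hadd' : ∀ S : Finset (Fin n), 2 < S.card → S.card ≤ k → SyncAt f lev S →
      ∃ A ∈ added, A.set n = S)
    (hW : MasksOK f W req) : bigLevel F ext rem added W req rem.length ≠ true := by
  classical
  induction F generalizing lev ext rem added W req with
  | zero => exact Bool.false_ne_true
  | succ F ih =>
    intro h
    simp only [bigLevel, sel_eq, forceSpine_eq] at h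
    have hget : ∀ j, ext.tail.getD j [] = ext.getD (j + 1) [] := fun j => by
      cases ext <;> simp
    have hprune : Nat.ble (Nat.add ext.tail.length rem.length) F = false := by
      rw [← Bool.not_eq_true, Nat.ble_eq, not_le]
      have := le_add_card_of_levels (f := f) (j := lev + ext.tail.length) (L := lev + (F + 1))
        (rem.map (Item.set n)).toFinset fun i h1 h2 => by
          obtain ⟨S, hS, hSi⟩ := hF i (by omega) h2
          refine ⟨S, ?_, hSi⟩
          rcases Nat.lt_or_ge 2 S.card with h3 | h3
          · obtain ⟨A, hA, rfl⟩ := hrem' S h3 hS ⟨i, hSi.1⟩ (hSi.2 lev (by omega))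
            simpa using ⟨A, hA, rfl⟩
          · obtain ⟨j, rfl⟩ := Nat.exists_eq_add_of_lt (show lev < i by omega)
            obtain ⟨B, hB, -⟩ := (hext (j + 1)).2 S h3 hSi
            rw [← hget, List.getD_eq_default _ _ (by omega)] at hB
            simp at hB
      have h2 := (List.toFinset_card_le (rem.map (Item.set n)))
      rw [List.length_map] at h2
      change F < ext.tail.length + rem.length
      omega
    rw [hprune, cond_false] at h
    have h0 : LayerOK f lev (ext.headD []) := by
      have := hext 0
      cases ext <;> simpa using this
    obtain ⟨W', req', hW', h⟩ := go_sound (f := f) (i := lev) one_ne_zero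
      (layer := added ++ ext.headD [])
      (fun B hB => (List.mem_append.1 hB).elim (hadd B) (h0.1 B)) rem
      (fun A hA => by
        obtain ⟨h1, h2, h3, h4⟩ := hrem A hA
        refine ⟨h1, h4, fun a ha => ?_, fun hne => absurd h3 hne⟩
        have hat := syncAt_image h4 ha
        rcases Nat.lt_or_ge 2 ((A.set n).image (f a)).card with hc | hc
        · obtain ⟨B, hB, he⟩ := hadd' _ hc (Finset.card_image_le.trans h2) hat
          exact ⟨B, List.mem_append_left _ hB, he.ge⟩
        · obtain ⟨B, hB, he⟩ := h0.2 _ hc hat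
          exact ⟨B, List.mem_append_right _ hB, he⟩)
      [] [] W req rem.length (by simp) (fun _ _ => rfl) hW h
    simp only [List.append_nil] at h
    set kept' := (rem.filter fun A => ¬ SyncIn f (lev + 1) (A.set n)).reverse with hk
    set added' := (rem.filter fun A => SyncIn f (lev + 1) (A.set n)).reverse with ha
    have hmk : ∀ A, A ∈ kept' ↔ A ∈ rem ∧ ¬ SyncIn f (lev + 1) (A.set n) := by simp [hk]
    have hma : ∀ A, A ∈ added' ↔ A ∈ rem ∧ SyncIn f (lev + 1) (A.set n) := by simp [ha]
    have hadd2 : ∀ S : Finset (Fin n), 2 < S.card → S.card ≤ k → SyncAt f (lev + 1) S →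
        ∃ A ∈ added', A.set n = S := fun S h2 hS hSi => by
      obtain ⟨A, hA, rfl⟩ := hrem' S h2 hS ⟨_, hSi.1⟩ (hSi.2 lev (Nat.lt_succ_self _))
      exact ⟨A, (hma A).2 ⟨hA, hSi.1⟩, rfl⟩
    by_cases hstuck : (added'.isEmpty && ext.tail.isEmpty) = true
    · rw [Bool.and_eq_true, List.isEmpty_iff, List.isEmpty_iff] at hstuck
      obtain ⟨S, hS, hSi⟩ := hF (lev + 1) (by omega) (by omega)
      rcases Nat.lt_or_ge 2 S.card with hc | hc
      · obtain ⟨A, hA, -⟩ := hadd2 S hc hS hSi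
        rw [hstuck.1] at hA
        simp at hA
      · obtain ⟨B, hB, -⟩ := (hext 1).2 S hc hSi
        rw [← hget, hstuck.2] at hB
        simp at hB
    · rw [Bool.not_eq_true] at hstuck
      rw [hstuck, cond_false] at h
      refine ih (lev + 1) (by rwa [Nat.add_right_comm]) ext.tail kept' added' W' req'
        (fun j => ?_) (fun A hA => ?_) (fun S h2 hS hi hn => ?_) (fun A hA => ?_) hadd2 hW' h
      · rw [hget, Nat.add_right_comm]
        exact hext (j + 1)
      · obtain ⟨hA, hn⟩ := (hmk A).1 hA
        obtain ⟨h1, h2, h3, -⟩ := hrem A hA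
        exact ⟨h1, h2, h3, hn⟩
      · obtain ⟨A, hA, rfl⟩ := hrem' S h2 hS hi fun h => hn h.succ
        exact ⟨A, (hmk A).2 ⟨hA, hn⟩, rfl⟩
      · obtain ⟨hA, hs⟩ := (hma A).1 hA
        exact ⟨(hrem A hA).1, hs⟩

theorem testBit_idMask (l : List Item) (b : ℕ) :
    (idMask l).testBit b = true ↔ ∃ A ∈ l, A.id = b := by
  induction l with
  | nil => simp [idMask]
  | cons A l ih =>
    change ((1 <<< A.id) ||| idMask l).testBit b = true ↔ _
    rw [Nat.testBit_or, Bool.or_eq_true, ih, Nat.one_shiftLeft, Nat.testBit_two_pow]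
    simp

variable (f) in
/-- The items of `rem` are the pairs of states not merged by words of length `lev`. -/
def RemOK (lev : ℕ) (rem : List Item) : Prop :=
  (∀ A ∈ rem, A.Valid f ∧ (A.set n).card = 2 ∧ ¬ SyncIn f lev (A.set n)) ∧
    ∀ S : Finset (Fin n), S.card = 2 → ¬ SyncIn f lev S → ∃ A ∈ rem, A.set n = S

theorem RemOK.card_openPairs_le {lev : ℕ} {rem : List Item} (h : RemOK f lev rem) :
    (openPairs f lev).card ≤ rem.length := by
  classical
  have : openPairs f lev ⊆ (rem.map (Item.set n)).toFinset := fun S hS => by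
    obtain ⟨A, hA, rfl⟩ := h.2 S (mem_openPairs.1 hS).1 (mem_openPairs.1 hS).2
    simpa using ⟨A, hA, rfl⟩
  have h2 := (List.toFinset_card_le (rem.map (Item.set n)))
  rw [List.length_map] at h2
  exact (Finset.card_le_card this).trans h2

variable (f) in
/-- What the pair search needs to know about the numbers in its parameters. -/
structure Params.OK (P : Params) : Prop where
  minTot : ∀ j, P.minTot ≤ j + (openPairs f j).card
  tri : ∀ lev rem, RemOK f lev rem → allHit (idMask rem) P.tri = true → HitWithin f 3 lev
  quad : ∀ lev rem, RemOK f lev rem → allHit (idMask rem) P.quad = true → HitWithin f 4 lev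
  thresholds : ∀ c c', HitWithin f 3 c → HitWithin f 4 c' → ∀ j,
    P.th3 ≤ j + ((openPairs f j).card + c) ∨ P.th4 ≤ j + ((openPairs f j).card + (c + c'))

theorem pairLevel_ne_true {P : Params} (hP : P.OK f) {Q : Item → Prop}
    {leaf : List Item → List (List Item) → ℕ → List ℕ → Bool}
    (hleaf : ∀ kept hist W req, (∀ A ∈ kept, ∀ i, ¬ SyncIn f i (A.set n)) →
      (∀ A ∈ kept, Q A) →
      (∀ j, LayerOK f j (hist.getD j [])) → MasksOK f W req → leaf kept hist W req ≠ true)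
    (F lev : ℕ) (hF : lev + F = 20) (rem layer : List Item) (hist : List (List Item)) (W : ℕ)
    (req : List ℕ) (c3 c4 : ℕ) (hrem : RemOK f lev rem)
    (hlvl : ∀ A ∈ rem, A.lvl ≠ 0 → ∀ j, 1 ≤ j → j ≤ 20 → (SyncAt f j (A.set n) ↔ A.lvl = j))
    (hQ : ∀ A ∈ rem, Q A) (hlayer : LayerOK f lev layer) (hlen : hist.length = lev + 1)
    (hhist : ∀ j ≤ lev, LayerOK f j (hist.getD j [])) (hW : MasksOK f W req)
    (h3 : c3 ≠ 0 → HitWithin f 3 c3) (h4 : c4 ≠ 0 → HitWithin f 4 c4) :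
    pairLevel P leaf F lev rem layer hist W req rem.length c3 c4 ≠ true := by
  classical
  induction F generalizing lev rem layer hist W req c3 c4 with
  | zero => exact Bool.false_ne_true
  | succ F ih =>
    intro h
    simp only [pairLevel, sel_eq, forceSpine_eq, force_eq] at h
    generalize hd3 : (bif Nat.beq c3 0 && allHit (idMask rem) P.tri then lev else c3) = d3 at h
    generalize hd4 : (bif Nat.beq c4 0 && allHit (idMask rem) P.quad then lev else c4) = d4 at h
    have h3' : d3 ≠ 0 → HitWithin f 3 d3 := by
      rw [← hd3]
      rcases hb : Nat.beq c3 0 && allHit (idMask rem) P.tri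
      · exact h3
      · exact fun _ => hP.tri lev rem hrem (Bool.and_eq_true .. ▸ hb).2
    have h4' : d4 ≠ 0 → HitWithin f 4 d4 := by
      rw [← hd4]
      rcases hb : Nat.beq c4 0 && allHit (idMask rem) P.quad
      · exact h4
      · exact fun _ => hP.quad lev rem hrem (Bool.and_eq_true .. ▸ hb).2
    have hopen := hrem.card_openPairs_le
    have hprune : (!(Nat.beq d3 0) && !(Nat.beq d4 0) &&
        !(Nat.ble P.th3 (Nat.add lev (Nat.add rem.length d3))) &&
        !(Nat.ble P.th4 (Nat.add lev (Nat.add rem.length (Nat.add d3 d4))))) = false := by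
      rw [← Bool.not_eq_true]
      simp only [Bool.and_eq_true, Bool.not_eq_true', ← Bool.not_eq_true, Nat.beq_eq, Nat.ble_eq,
        not_le, Nat.add_eq]
      rintro ⟨⟨⟨g3, g4⟩, k3⟩, k4⟩
      rcases hP.thresholds d3 d4 (h3' g3) (h4' g4) lev with h | h <;> omega
    rw [hprune, cond_false] at h
    have himg : ∀ A ∈ rem, ∀ a, SyncIn f lev ((A.set n).image (f a)) →
        ∃ B ∈ layer, (A.set n).image (f a) ⊆ B.set n := fun A hA a ha =>
      hlayer.2 _ (Finset.card_image_le.trans (hrem.1 A hA).2.1.le)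
        (syncAt_image (hrem.1 A hA).2.2 ha)
    set kept' := (rem.filter fun A => ¬ SyncIn f (lev + 1) (A.set n)).reverse with hk
    set added' := (rem.filter fun A => SyncIn f (lev + 1) (A.set n)).reverse with ha
    have hmk : ∀ A, A ∈ kept' ↔ A ∈ rem ∧ ¬ SyncIn f (lev + 1) (A.set n) := by simp [hk]
    have hma : ∀ A, A ∈ added' ↔ A ∈ rem ∧ SyncIn f (lev + 1) (A.set n) := by simp [ha]
    have hrem' : RemOK f (lev + 1) kept' := by
      refine ⟨fun A hA => ?_, fun S hS hn => ?_⟩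
      · obtain ⟨hA, hn⟩ := (hmk A).1 hA
        exact ⟨(hrem.1 A hA).1, (hrem.1 A hA).2.1, hn⟩
      · obtain ⟨A, hA, rfl⟩ := hrem.2 S hS fun h => hn h.succ
        exact ⟨A, (hmk A).2 ⟨hA, hn⟩, rfl⟩
    obtain ⟨W', req', hW', h⟩ := go_sound (f := f) (i := lev) (Nat.succ_ne_zero lev)
      hlayer.1 rem
      (fun A hA => ⟨(hrem.1 A hA).1, (hrem.1 A hA).2.2, himg A hA, fun hne => by
        rw [← hlvl A hA hne (lev + 1) (by omega) (by omega), syncAt_succ_iff]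
        exact (and_iff_left (hrem.1 A hA).2.2).symm⟩)
      [] [] W req rem.length (by simp) (fun t ht => by
        rw [List.append_nil] at ht
        change kept'.length ≤ t at ht
        rw [Nat.ble_eq]
        change P.minTot ≤ t + (lev + 1)
        have h1 := hP.minTot (lev + 1)
        have h2 := hrem'.card_openPairs_le
        omega) hW h
    simp only [List.append_nil] at h
    rw [← hk, ← ha] at h
    have hadd : ∀ S : Finset (Fin n), S.card ≤ 2 → SyncAt f (lev + 1) S →
        ∃ A ∈ added', A.set n = S := fun S hS hSi => by
      have := hSi.one_lt_card (by omega)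
      obtain ⟨A, hA, rfl⟩ := hrem.2 S (by omega) (hSi.2 lev (Nat.lt_succ_self _))
      exact ⟨A, (hma A).2 ⟨hA, hSi.1⟩, rfl⟩
    have hlayer' : LayerOK f (lev + 1) added' := by
      refine ⟨fun B hB => ⟨(hrem.1 B ((hma B).1 hB).1).1, ((hma B).1 hB).2⟩, fun S hS hSi => ?_⟩
      obtain ⟨A, hA, he⟩ := hadd S hS hSi
      exact ⟨A, hA, he.ge⟩
    rcases hempty : added'.isEmpty
    · rw [hempty, cond_false] at h
      refine ih (lev + 1) (by omega) kept' added' (hist ++ [added']) W' req' d3 d4 hrem'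
        (fun A hA => hlvl A ((hmk A).1 hA).1)
        (fun A hA => hQ A ((hmk A).1 hA).1) hlayer' (by simp [hlen]) (fun j hj => ?_) hW' h3' h4' h
      rcases Nat.lt_or_ge lev j with hj' | hj'
      · obtain rfl : j = lev + 1 := by omega
        rw [List.getD_append_right _ _ _ _ (by omega)]
        simpa [hlen] using hlayer'
      · rw [List.getD_append _ _ _ _ (by omega)]
        exact hhist j hj'
    · rw [hempty, cond_true] at h
      rw [List.isEmpty_iff] at hempty
      have hnone : ∀ j, lev < j → ∀ S : Finset (Fin n), S.card ≤ 2 → ¬ SyncAt f j S := by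
        intro j hj S hS hSi
        obtain ⟨T, hT, hTi⟩ := hSi.levelsUpTo hS (lev + 1) (by omega) (by omega)
        obtain ⟨A, hA, -⟩ := hadd T hT hTi
        rw [hempty] at hA
        simp at hA
      have hnever : ∀ S : Finset (Fin n), S.card = 2 → ¬ SyncIn f (lev + 1) S →
          ∀ i, ¬ SyncIn f i S := fun S hS hn i hi => by
        obtain ⟨j, -, hj⟩ := hi.exists_syncAt
        rcases Nat.lt_or_ge lev j with h' | h'
        · exact hnone j h' S hS.le hj
        · exact hn (hj.1.mono (by omega))
      refine hleaf kept' hist W' req' (fun A hA => hnever _ (hrem'.1 A hA).2.1 (hrem'.1 A hA).2.2)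
        (fun A hA => hQ A ((hmk A).1 hA).1) (fun j => ?_) hW' h
      rcases Nat.lt_or_ge lev j with hj' | hj'
      · rw [List.getD_eq_default _ _ (by omega)]
        exact ⟨fun B hB => absurd hB List.not_mem_nil,
          fun S hS hSi => absurd hSi (hnone j hj' S hS)⟩
      · exact hhist j hj'

end Levelwise

/-- The data of an item: code of the set, letter filter, prescribed level. -/
abbrev ItemData := ℕ × (ℕ → ℕ → ℕ → ℕ → ℕ → ℕ → ℕ) × ℕ

/-- The letter filter of the set with code `b`, as a fold. -/
def actOf (b W m0 m1 m2 m3 m4 : ℕ) : ℕ :=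
  [(0, m0), (1, m1), (2, m2), (3, m3), (4, m4)].foldr
    (fun p acc => bif b.testBit p.1 then Nat.land p.2 acc else acc) W

def toItem (n : ℕ) (t : ItemData) : Item where
  id := t.1
  act := t.2.1
  pre := fun k => k (scramble (Nat.shiftLeft (preMask n t.1 0) 64))
    (scramble (Nat.shiftLeft (preMask n t.1 1) 64))
    (scramble (Nat.shiftLeft (preMask n t.1 2) 64))
    (scramble (Nat.shiftLeft (preMask n t.1 3) 64))
    (scramble (Nat.shiftLeft (preMask n t.1 4) 64))
  lvl := t.2.2

theorem withItems_eq {β : Type} (n : ℕ) (l : List ItemData) (k : List Item → β) :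
    withItems n l k = k (l.map (toItem n)) := by
  induction l generalizing k with
  | nil => rfl
  | cons t l ih =>
    obtain ⟨b, m, c⟩ := t
    simp only [withItems, force_eq, ih, List.map_cons]
    rfl

theorem toItem_valid {n : ℕ} {α : Type} (f : α → Fin n → Fin n) (hn : n ≤ 5) {t : ItemData}
    (ht : t.2.1 = actOf t.1) (hlt : t.1 < 2 ^ n) : (toItem n t).Valid f := by
  refine ⟨hlt, fun p => scramble (Nat.shiftLeft (preMask n t.1 p) 64), fun _ => rfl,
    fun a p => hasLetter_preMask _ a p, fun W M c => ?_⟩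
  change (t.2.1 W (M 0) (M 1) (M 2) (M 3) (M 4)).testBit c = true ↔ _
  have hfold : ∀ l : List ℕ, ((l.map fun p => (p, M p)).foldr
      (fun p acc => bif t.1.testBit p.1 then Nat.land p.2 acc else acc) W).testBit c = true ↔
      W.testBit c = true ∧ ∀ p ∈ l, t.1.testBit p = true → (M p).testBit c = true := fun l => by
    induction l with
    | nil => simp
    | cons p l ih =>
      rw [List.map_cons, List.foldr_cons, List.forall_mem_cons]
      cases hp : t.1.testBit p
      · simpa using ih
      · change (M p &&& _).testBit c = true ↔ _
        rw [Nat.testBit_and, Bool.and_eq_true, ih]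
        simp only [true_implies]
        tauto
  rw [ht]
  refine (hfold [0, 1, 2, 3, 4]).trans (and_congr_right fun _ =>
    ⟨fun h p hp => ?_, fun h p _ hp => ?_⟩)
  · refine h p ?_ (Finset.mem_filter.1 hp).2
    have := p.isLt
    simp only [List.mem_cons, List.not_mem_nil]
    omega
  · have hpn : p < n := by
      by_contra hc
      rw [Nat.testBit_lt_two_pow (hlt.trans_le (Nat.pow_le_pow_right two_pos (not_lt.1 hc)))] at hp
      exact Bool.noConfusion hp
    exact h ⟨p, hpn⟩ (Finset.mem_filter.2 ⟨Finset.mem_univ _, hp⟩)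

/-- The complete search: first the levels of the pairs, then those of the larger sets. -/
def search (n : ℕ) (P : Params) (closed : Bool) (L3 L4 : ℕ) (single pair tri quad : List ItemData)
    (W : ℕ) : Bool :=
  withItems n single fun single =>
  withItems n pair fun pair =>
  withItems n tri fun tri =>
  withItems n quad fun quad =>
  force W fun W =>
  force pair.length fun s2 =>
  force tri.length fun s3 =>
  forceSpine (tri ++ quad) fun big =>
  force big.length fun s4 =>
  pairLevel P (fun kept hist W req =>
    sel (closed && freeItem kept) true
      (bigLevel L3 hist tri [] W req s3 && bigLevel L4 hist big [] W req s4))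
    20 0 pair single [single] W [] s2 0 0

/-- Faithful codes and letter filters. -/
def DataOK (n c : ℕ) (l : List ItemData) : Prop :=
  ∀ t ∈ l, t.2.1 = actOf t.1 ∧ t.1 < 2 ^ n ∧ (bitSet n t.1).card = c

theorem search_sound {n : ℕ} {α : Type} {f : α → Fin n → Fin n} (hn : n ≤ 5) (hn0 : 0 < n)
    {P : Params} (hP : P.OK f) {closed : Bool} {L3 L4 : ℕ} {single pair tri quad : List ItemData}
    {W : ℕ} (hs1 : DataOK n 1 single) (hs2 : ∀ p : Fin n, ∃ t ∈ single, bitSet n t.1 = {p})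
    (hp1 : DataOK n 2 pair)
    (hp2 : ∀ S : Finset (Fin n), S.card = 2 → ∃ t ∈ pair, bitSet n t.1 = S)
    (hlvl : ∀ t ∈ pair, t.2.2 ≠ 0 → ∀ j, 1 ≤ j → j ≤ 20 →
      (SyncAt f j (bitSet n t.1) ↔ t.2.2 = j))
    (hclosed : closed = true → ∀ t ∈ pair, t.2.2 = 0 → ∃ i, SyncIn f i (bitSet n t.1))
    (ht1 : DataOK n 3 tri) (ht2 : ∀ t ∈ tri, t.2.2 = 0)
    (ht3 : ∀ S : Finset (Fin n), S.card = 3 → (∃ i, SyncIn f i S) → ∃ t ∈ tri, bitSet n t.1 = S)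
    (hq1 : DataOK n 4 quad) (hq2 : ∀ t ∈ quad, t.2.2 = 0)
    (hq3 : ∀ S : Finset (Fin n), S.card = 4 → (∃ i, SyncIn f i S) → ∃ t ∈ quad, bitSet n t.1 = S)
    (hW : ∀ a, HasLetter f W a)
    (h : search n P closed L3 L4 single pair tri quad W = true) :
    ¬ LevelsUpTo f 3 L3 ∧ ¬ LevelsUpTo f 4 L4 := by
  by_contra hbad
  rw [← not_or, not_not] at hbad
  have hval : ∀ {c l}, DataOK n c l → ∀ A ∈ l.map (toItem n), A.Valid f ∧ (A.set n).card = c := by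
    intro c l hl A hA
    obtain ⟨t, ht, rfl⟩ := List.mem_map.1 hA
    obtain ⟨h1, h2, h3⟩ := hl t ht
    exact ⟨toItem_valid f hn h1 h2, h3⟩
  have hex : ∀ {l : List ItemData} {S : Finset (Fin n)}, (∃ t ∈ l, bitSet n t.1 = S) →
      ∃ A ∈ l.map (toItem n), A.set n = S := by
    rintro l S ⟨t, ht, rfl⟩
    exact ⟨toItem n t, List.mem_map.2 ⟨t, ht, rfl⟩, rfl⟩
  have hnot : ∀ {S : Finset (Fin n)}, 1 < S.card → ¬ SyncIn f 0 S := fun h => not_le.2 h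
  have hlay : LayerOK f 0 (single.map (toItem n)) := by
    refine ⟨fun B hB => ⟨(hval hs1 B hB).1, (hval hs1 B hB).2.le⟩, fun S _ hSi => ?_⟩
    rcases S.eq_empty_or_nonempty with rfl | ⟨p, hp⟩
    · obtain ⟨A, hA, -⟩ := hex (hs2 ⟨0, hn0⟩)
      exact ⟨A, hA, Finset.empty_subset _⟩
    · obtain ⟨A, hA, he⟩ := hex (hs2 p)
      refine ⟨A, hA, he ▸ fun q hq => Finset.mem_singleton.2 ?_⟩
      exact Finset.card_le_one.1 hSi.1 q hq p hp
  simp only [search, withItems_eq, force_eq, forceSpine_eq] at h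
  refine pairLevel_ne_true hP (Q := fun A => ∃ t ∈ pair, toItem n t = A)
    (fun kept hist W' req hnever hQ hhist hW' hleaf => ?_) 20 0 rfl _ _ _ W [] 0 0
    ⟨fun A hA => ⟨(hval hp1 A hA).1, (hval hp1 A hA).2, hnot (by rw [(hval hp1 A hA).2]; omega)⟩,
      fun S hS _ => hex (hp2 S hS)⟩
    (fun A hA => by obtain ⟨t, ht, rfl⟩ := List.mem_map.1 hA; exact hlvl t ht)
    (fun A hA => List.mem_map.1 hA) hlay rfl
    (fun j hj => by
      obtain rfl : j = 0 := by omega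
      exact hlay)
    ⟨hW, by simp⟩ (by simp) (by simp) h
  have hfree : (closed && freeItem kept) = false := by
    rw [← Bool.not_eq_true, Bool.and_eq_true, freeItem, List.any_eq_true]
    rintro ⟨hc, A, hA, hl⟩
    obtain ⟨t, ht, rfl⟩ := hQ A hA
    obtain ⟨i, hi⟩ := hclosed hc t ht (Nat.beq_eq.mp hl)
    exact hnever _ hA i hi
  rw [sel_eq, hfree, cond_false, Bool.and_eq_true] at hleaf
  have key : ∀ (k : ℕ) (L : ℕ) (big : List ItemData),
      (∀ t ∈ big, t.2.1 = actOf t.1 ∧ t.1 < 2 ^ n ∧ 2 < (bitSet n t.1).card ∧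
        (bitSet n t.1).card ≤ k ∧ t.2.2 = 0) →
      (∀ S : Finset (Fin n), 2 < S.card → S.card ≤ k → (∃ i, SyncIn f i S) →
        ∃ t ∈ big, bitSet n t.1 = S) →
      LevelsUpTo f k L →
      bigLevel L hist (big.map (toItem n)) [] W' req (big.map (toItem n)).length ≠ true := by
    intro k L big hb1 hb2 hL
    refine bigLevel_ne_true L 0 (by rwa [Nat.zero_add]) hist _ [] W' req
      (fun j => by rw [Nat.zero_add]; exact hhist j) (fun A hA => ?_)
      (fun S h2 hS hi _ => hex (hb2 S h2 hS hi)) (by simp)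
      (fun S h2 _ hSi => absurd hSi.1 (hnot (by omega))) hW'
    obtain ⟨t, ht, rfl⟩ := List.mem_map.1 hA
    obtain ⟨h1, h2, h3, h4, h5⟩ := hb1 t ht
    exact ⟨toItem_valid f hn h1 h2, h4, h5, hnot (lt_trans one_lt_two h3)⟩
  rcases hbad with hL | hL
  · refine key 3 L3 tri (fun t ht => ?_) (fun S h2 hS hi => ht3 S (by omega) hi) hL hleaf.1
    obtain ⟨h1, h2, h3⟩ := ht1 t ht
    exact ⟨h1, h2, by omega, by omega, ht2 t ht⟩
  · refine key 4 L4 (tri ++ quad) (fun t ht => ?_) (fun S h2 hS hi => ?_) hL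
      (by rw [List.map_append]; exact hleaf.2)
    · rcases List.mem_append.1 ht with ht | ht
      · obtain ⟨h1, h2, h3⟩ := ht1 t ht
        exact ⟨h1, h2, by omega, by omega, ht2 t ht⟩
      · obtain ⟨h1, h2, h3⟩ := hq1 t ht
        exact ⟨h1, h2, by omega, by omega, hq2 t ht⟩
    · rcases (show S.card = 3 ∨ S.card = 4 by omega) with hS | hS
      · obtain ⟨t, ht, he⟩ := ht3 S hS hi
        exact ⟨t, List.mem_append_left _ ht, he⟩
      · obtain ⟨t, ht, he⟩ := hq3 S hS hi
        exact ⟨t, List.mem_append_right _ ht, he⟩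

section Data

def singleData : List ItemData :=
  [
    (1, fun W a _ _ _ _ => Nat.land a W, 0),
    (2, fun W _ b _ _ _ => Nat.land b W, 0),
    (4, fun W _ _ c _ _ => Nat.land c W, 0),
    (8, fun W _ _ _ d _ => Nat.land d W, 0),
    (16, fun W _ _ _ _ e => Nat.land e W, 0)]

/-- The ten pairs, with prescribed levels for the pairs `{0, 1}`, `{0, 2}` and `{2, 3}`. -/
def pairData (x y z : ℕ) : List ItemData :=
  [
    (3, fun W a b _ _ _ => Nat.land a (Nat.land b W), x),
    (5, fun W a _ c _ _ => Nat.land a (Nat.land c W), y),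
    (6, fun W _ b c _ _ => Nat.land b (Nat.land c W), 0),
    (9, fun W a _ _ d _ => Nat.land a (Nat.land d W), 0),
    (10, fun W _ b _ d _ => Nat.land b (Nat.land d W), 0),
    (12, fun W _ _ c d _ => Nat.land c (Nat.land d W), z),
    (17, fun W a _ _ _ e => Nat.land a (Nat.land e W), 0),
    (18, fun W _ b _ _ e => Nat.land b (Nat.land e W), 0),
    (20, fun W _ _ c _ e => Nat.land c (Nat.land e W), 0),
    (24, fun W _ _ _ d e => Nat.land d (Nat.land e W), 0)]

def tripleData : List ItemData :=
  [
    (7, fun W a b c _ _ => Nat.land a (Nat.land b (Nat.land c W)), 0),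
    (11, fun W a b _ d _ => Nat.land a (Nat.land b (Nat.land d W)), 0),
    (13, fun W a _ c d _ => Nat.land a (Nat.land c (Nat.land d W)), 0),
    (14, fun W _ b c d _ => Nat.land b (Nat.land c (Nat.land d W)), 0),
    (19, fun W a b _ _ e => Nat.land a (Nat.land b (Nat.land e W)), 0),
    (21, fun W a _ c _ e => Nat.land a (Nat.land c (Nat.land e W)), 0),
    (22, fun W _ b c _ e => Nat.land b (Nat.land c (Nat.land e W)), 0),
    (25, fun W a _ _ d e => Nat.land a (Nat.land d (Nat.land e W)), 0),
    (26, fun W _ b _ d e => Nat.land b (Nat.land d (Nat.land e W)), 0),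
    (28, fun W _ _ c d e => Nat.land c (Nat.land d (Nat.land e W)), 0)]

def quadData : List ItemData :=
  [
    (15, fun W a b c d _ => Nat.land a (Nat.land b (Nat.land c (Nat.land d W))), 0),
    (23, fun W a b c _ e => Nat.land a (Nat.land b (Nat.land c (Nat.land e W))), 0),
    (27, fun W a b _ d e => Nat.land a (Nat.land b (Nat.land d (Nat.land e W))), 0),
    (29, fun W a _ c d e => Nat.land a (Nat.land c (Nat.land d (Nat.land e W))), 0),
    (30, fun W _ b c d e => Nat.land b (Nat.land c (Nat.land d (Nat.land e W))), 0)]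

/-- The items whose set does not contain the set with code `x`. -/
def avoid (x : ℕ) (l : List ItemData) : List ItemData :=
  l.filter fun t => !Nat.beq (Nat.land t.1 x) x

/-- The mask of all letters. -/
def fullMask (n : ℕ) : ℕ := Nat.sub (Nat.pow 2 (Nat.add (Nat.pow n n) 64)) 1

/-- The mask of the letters mapping the states `0` and `1` into `{0, 1}`. -/
def stableMask (n : ℕ) : ℕ :=
  Nat.land (Nat.land (fullMask n) (Nat.shiftLeft (preMask n 3 0) 64))
    (Nat.shiftLeft (preMask n 3 1) 64)

def syncParams : Params where
  th3 := 14
  th4 := 16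
  minTot := 6
  tri := [104, 1544, 4640, 5184, 393224, 1179680, 1310784, 16908800, 17040384, 17829888]
  quad := [5736, 1441896, 17171976, 17961504, 18093120]

/-- Parameters for which only the bound on the number of open pairs is used. -/
def countParams (m : ℕ) : Params where
  th3 := 0
  th4 := 0
  minTot := m
  tri := [0]
  quad := [0]

end Data

set_option maxRecDepth 100000 in
theorem search_five_adjacent :
    search 5 syncParams true 14 16 singleData (pairData 1 2 0) tripleData quadData
      (fullMask 5) = true := by
  decide +kernel

set_option maxRecDepth 100000 in
theorem search_five_disjoint :
    search 5 syncParams true 14 16 singleData (pairData 1 0 2) tripleData quadData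
      (fullMask 5) = true := by
  decide +kernel

set_option maxRecDepth 100000 in
theorem search_four_adjacent :
    search 4 (countParams 5) true 9 10 (singleData.take 4) ((pairData 1 2 0).take 6)
      (tripleData.take 4) (quadData.take 1) (fullMask 4) = true := by
  decide +kernel

set_option maxRecDepth 100000 in
theorem search_four_disjoint :
    search 4 (countParams 5) true 9 10 (singleData.take 4) ((pairData 1 0 2).take 6)
      (tripleData.take 4) (quadData.take 1) (fullMask 4) = true := by
  decide +kernel

set_option maxRecDepth 100000 in
theorem search_stable :
    search 5 (countParams 7) true 13 15 singleData (pairData 99 0 0)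
      (avoid 3 tripleData) (avoid 3 quadData) (stableMask 5) = true := by
  decide +kernel

set_option maxRecDepth 100000 in
theorem search_unmerged_adjacent :
    search 5 (countParams 10) false 13 15 singleData (pairData 99 99 0)
      (avoid 5 (avoid 3 tripleData)) (avoid 5 (avoid 3 quadData)) (fullMask 5) = true := by
  decide +kernel

set_option maxRecDepth 100000 in
theorem search_unmerged_disjoint :
    search 5 (countParams 11) false 13 15 singleData (pairData 99 0 99)
      (avoid 12 (avoid 3 tripleData)) (avoid 12 (avoid 3 quadData)) (fullMask 5) = true := by
  decide +kernel

section Bounds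

variable {n : ℕ} {α : Type} {f : α → Fin n → Fin n}

theorem pairData_act (x y z : ℕ) : ∀ t ∈ pairData x y z, t.2.1 = actOf t.1 := by
  simp only [pairData, List.forall_mem_cons]
  refine ⟨?_, ?_, ?_, ?_, ?_, ?_, ?_, ?_, ?_, ?_, by simp⟩ <;> funext _ _ _ _ _ _ <;>
    simp [actOf, Nat.testBit]

theorem singleData_act : ∀ t ∈ singleData, t.2.1 = actOf t.1 := by
  simp only [singleData, List.forall_mem_cons]
  refine ⟨?_, ?_, ?_, ?_, ?_, by simp⟩ <;> funext _ _ _ _ _ _ <;>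
    simp [actOf, Nat.testBit]

theorem tripleData_act : ∀ t ∈ tripleData, t.2.1 = actOf t.1 := by
  simp only [tripleData, List.forall_mem_cons]
  refine ⟨?_, ?_, ?_, ?_, ?_, ?_, ?_, ?_, ?_, ?_, by simp⟩ <;> funext _ _ _ _ _ _ <;>
    simp [actOf, Nat.testBit]

theorem quadData_act : ∀ t ∈ quadData, t.2.1 = actOf t.1 := by
  simp only [quadData, List.forall_mem_cons]
  refine ⟨?_, ?_, ?_, ?_, ?_, by simp⟩ <;> funext _ _ _ _ _ _ <;>
    simp [actOf, Nat.testBit]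

theorem dataOK_of_codes {c : ℕ} {l : List ItemData} (h : ∀ t ∈ l, t.2.1 = actOf t.1)
    (hc : ∀ b ∈ l.map Prod.fst, b < 2 ^ n ∧ (bitSet n b).card = c) : DataOK n c l :=
  fun t ht => ⟨h t ht, hc _ (List.mem_map_of_mem ht)⟩

theorem exists_data_of_codes {l : List ItemData} {S : Finset (Fin n)}
    (h : ∃ b ∈ l.map Prod.fst, bitSet n b = S) : ∃ t ∈ l, bitSet n t.1 = S := by
  obtain ⟨b, hb, rfl⟩ := h
  obtain ⟨t, ht, rfl⟩ := List.mem_map.1 hb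
  exact ⟨t, ht, rfl⟩

theorem pairData_lvl {x y z : ℕ}
    (hx : x ≠ 0 → ∀ j, 1 ≤ j → j ≤ 20 → (SyncAt f j (bitSet n 3) ↔ x = j))
    (hy : y ≠ 0 → ∀ j, 1 ≤ j → j ≤ 20 → (SyncAt f j (bitSet n 5) ↔ y = j))
    (hz : z ≠ 0 → ∀ j, 1 ≤ j → j ≤ 20 → (SyncAt f j (bitSet n 12) ↔ z = j)) :
    ∀ t ∈ pairData x y z, t.2.2 ≠ 0 → ∀ j, 1 ≤ j → j ≤ 20 →
      (SyncAt f j (bitSet n t.1) ↔ t.2.2 = j) := by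
  simp only [pairData, List.forall_mem_cons]
  refine ⟨hx, hy, ?_, ?_, ?_, hz, ?_, ?_, ?_, ?_, by simp⟩ <;> exact fun h => absurd rfl h

theorem SyncAt.iff {i : ℕ} {S : Finset (Fin n)} (h : SyncAt f i S) (j : ℕ) :
    SyncAt f j S ↔ i = j :=
  ⟨fun h' => h.unique h', fun he => he ▸ h⟩

theorem syncAt_iff_of_never {S : Finset (Fin n)} (h : ∀ i, ¬ SyncIn f i S) {j : ℕ} (hj : j ≤ 20) :
    SyncAt f j S ↔ 99 = j :=
  ⟨fun h' => absurd h'.1 (h j), fun he => by omega⟩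

theorem hasLetter_fullMask (a : α) : HasLetter f (fullMask n) a := by
  change (2 ^ (n ^ n + 64) - 1).testBit (finFunctionFinEquiv (f a) + 64) = true
  rw [Nat.testBit_two_pow_sub_one, decide_eq_true_iff]
  exact Nat.add_lt_add_right (finFunctionFinEquiv (f a)).isLt 64

theorem allHit_zero (m : ℕ) : allHit m [0] = false := by
  have : Nat.beq (Nat.land 0 m) 0 = true := by
    rw [Nat.beq_eq]; exact Nat.zero_and m
  rw [allHit, this]
  rfl

theorem countParams_ok {m : ℕ} (h : ∀ j, m ≤ j + (openPairs f j).card) : (countParams m).OK f where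
  minTot := h
  tri _ _ _ h := by rw [countParams, allHit_zero] at h; exact Bool.noConfusion h
  quad _ _ _ h := by rw [countParams, allHit_zero] at h; exact Bool.noConfusion h
  thresholds _ _ _ _ _ := Or.inl (Nat.zero_le _)

theorem allHit_spec {m : ℕ} {l : List ℕ} (h : allHit m l = true) :
    ∀ t ∈ l, ∃ b, t.testBit b = true ∧ m.testBit b = false := by
  induction l with
  | nil => simp
  | cons t l ih =>
    rw [allHit, sel_eq] at h
    rcases hb : Nat.beq (Nat.land t m) t
    · rw [hb, cond_false] at h
      refine List.forall_mem_cons.2 ⟨?_, ih h⟩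
      by_contra! hc
      rw [← Bool.not_eq_true, Nat.beq_eq] at hb
      refine hb (Nat.eq_of_testBit_eq fun b => ?_)
      change (t &&& m).testBit b = _
      rw [Nat.testBit_and]
      rcases hbt : t.testBit b
      · rfl
      · simpa using hc b hbt
    · rw [hb] at h
      exact Bool.noConfusion h

theorem hitWithin_of_allHit {r lev : ℕ} {rem : List Item} {l : List ℕ} (hrem : RemOK f lev rem)
    (hl : ∀ T : Finset (Fin n), T.card = r → ∃ t ∈ l, t < 2 ^ 2 ^ n ∧
      ∀ b < 2 ^ n, t.testBit b = true → (bitSet n b).card = 2 ∧ bitSet n b ⊆ T)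
    (hinj : ∀ b < 2 ^ n, ∀ b' < 2 ^ n, bitSet n b = bitSet n b' → b = b')
    (h : allHit (idMask rem) l = true) : HitWithin f r lev := by
  intro T hT
  obtain ⟨t, ht, hlt, hsub⟩ := hl T hT
  obtain ⟨b, hb, hm⟩ := allHit_spec h t ht
  have hbn : b < 2 ^ n := by
    by_contra hc
    rw [Nat.testBit_lt_two_pow (hlt.trans_le (Nat.pow_le_pow_right two_pos (not_lt.1 hc)))] at hb
    exact Bool.noConfusion hb
  obtain ⟨hc, hbT⟩ := hsub b hbn hb
  refine ⟨_, hbT, hc, ?_⟩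
  by_contra hn
  obtain ⟨A, hA, he⟩ := hrem.2 _ hc hn
  rw [← Bool.not_eq_true, testBit_idMask] at hm
  exact hm ⟨A, hA, hinj _ (hrem.1 A hA).1.1 b hbn he⟩

end Bounds

section Bounds

variable {n : ℕ} {α : Type} {f : α → Fin n → Fin n}

theorem exists_syncAt_pair (hp : ∀ P : Finset (Fin n), P.card = 2 → ∃ i, SyncIn f i P) {j : ℕ}
    (hj : 0 < (openPairs f j).card) : ∃ P : Finset (Fin n), P.card = 2 ∧ SyncAt f (j + 1) P := by
  obtain ⟨P, hP⟩ := Finset.card_pos.1 hj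
  obtain ⟨hP2, hPj⟩ := mem_openPairs.1 hP
  obtain ⟨i, hi⟩ := hp P hP2
  obtain ⟨L, -, hL⟩ := hi.exists_syncAt
  have hjL : j < L := by
    by_contra hc
    exact hPj (hL.1.mono (not_lt.1 hc))
  obtain ⟨S, hS, hSj⟩ := hL.levelsUpTo hP2.le (j + 1) (by omega) hjL
  have := hSj.one_lt_card (by omega)
  exact ⟨S, by omega, hSj⟩

theorem exists_perm_four : ∀ P Q : Finset (Fin 4), P.card = 2 → Q.card = 2 → P ≠ Q →
    ∃ σ : Equiv.Perm (Fin 4), (bitSet 4 3).image σ = P ∧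
      ((bitSet 4 5).image σ = Q ∨ (bitSet 4 12).image σ = Q) := by
  decide +kernel

theorem exists_perm_five : ∀ P Q : Finset (Fin 5), P.card = 2 → Q.card = 2 → P ≠ Q →
    ∃ σ : Equiv.Perm (Fin 5), (bitSet 5 3).image σ = P ∧
      ((bitSet 5 5).image σ = Q ∨ (bitSet 5 12).image σ = Q) := by
  decide +kernel

theorem forall_exists_syncIn_conj (σ : Equiv.Perm (Fin n))
    (hp : ∀ P : Finset (Fin n), P.card = 2 → ∃ i, SyncIn f i P) (P : Finset (Fin n))
    (hP : P.card = 2) : ∃ i, SyncIn (fun a p => σ.symm (f a (σ p))) i P := by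
  obtain ⟨i, hi⟩ := hp (P.image σ) (by rw [Finset.card_image_of_injective _ σ.injective, hP])
  exact ⟨i, syncIn_conj σ |>.2 hi⟩

theorem levelsUpTo_of_conj (σ : Equiv.Perm (Fin n)) {k L : ℕ}
    (h : ¬ LevelsUpTo (fun a p => σ.symm (f a (σ p))) k L) : ¬ LevelsUpTo f k L :=
  fun hf => h (levelsUpTo_conj σ hf)

/-- Moving the pairs of the first two levels to a standard position. -/
theorem exists_conj_of_pairs
    (hσ : ∀ P Q : Finset (Fin n), P.card = 2 → Q.card = 2 → P ≠ Q →
      ∃ σ : Equiv.Perm (Fin n), (bitSet n 3).image σ = P ∧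
        ((bitSet n 5).image σ = Q ∨ (bitSet n 12).image σ = Q))
    (hp : ∀ P : Finset (Fin n), P.card = 2 → ∃ i, SyncIn f i P)
    (h0 : 0 < (openPairs f 0).card) (h1 : 0 < (openPairs f 1).card) :
    ∃ σ : Equiv.Perm (Fin n), SyncAt (fun a p => σ.symm (f a (σ p))) 1 (bitSet n 3) ∧
      (SyncAt (fun a p => σ.symm (f a (σ p))) 2 (bitSet n 5) ∨
        SyncAt (fun a p => σ.symm (f a (σ p))) 2 (bitSet n 12)) := by
  obtain ⟨P, hP, hP1⟩ := exists_syncAt_pair hp h0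
  obtain ⟨Q, hQ, hQ2⟩ := exists_syncAt_pair hp h1
  obtain ⟨σ, h3, h⟩ := hσ P Q hP hQ fun he => by
    have := hP1.unique (he ▸ hQ2)
    omega
  refine ⟨σ, (syncAt_conj σ).2 (h3 ▸ hP1), h.imp (fun h => ?_) fun h => ?_⟩ <;>
    exact (syncAt_conj σ).2 (h ▸ hQ2)

theorem singleData_five : DataOK 5 1 singleData :=
  dataOK_of_codes singleData_act (by decide +kernel)

theorem pairData_five (x y z : ℕ) : DataOK 5 2 (pairData x y z) :=
  dataOK_of_codes (pairData_act x y z)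
    (show ∀ b ∈ (pairData 0 0 0).map Prod.fst, _ by decide +kernel)

theorem exists_pairData_five (x y z : ℕ) {S : Finset (Fin 5)} (hS : S.card = 2) :
    ∃ t ∈ pairData x y z, bitSet 5 t.1 = S := by
  refine exists_data_of_codes (show ∃ b ∈ (pairData 0 0 0).map Prod.fst, _ from ?_)
  revert S
  decide +kernel

theorem tripleData_five : DataOK 5 3 tripleData :=
  dataOK_of_codes tripleData_act (by decide +kernel)

theorem quadData_five : DataOK 5 4 quadData :=
  dataOK_of_codes quadData_act (by decide +kernel)

theorem DataOK.sublist {c : ℕ} {l l' : List ItemData} (h : DataOK n c l) (hl : l'.Sublist l) :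
    DataOK n c l' := fun t ht => h t (hl.subset ht)

theorem avoid_sublist (x : ℕ) (l : List ItemData) : (avoid x l).Sublist l :=
  List.filter_sublist

theorem tripleData_lvl : ∀ t ∈ tripleData, t.2.2 = 0 := by decide +kernel

theorem quadData_lvl : ∀ t ∈ quadData, t.2.2 = 0 := by decide +kernel

theorem bitSet_five_injOn : ∀ b < 2 ^ 5, ∀ b' < 2 ^ 5, bitSet 5 b = bitSet 5 b' → b = b' := by
  decide +kernel

end Bounds

section Synchronizing

variable {n : ℕ} {α : Type} {f : α → Fin n → Fin n}

theorem not_levelsUpTo_two_of_pairs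
    (hp : ∀ P : Finset (Fin n), P.card = 2 → ∃ i, SyncIn f i P) :
    ¬ LevelsUpTo f 2 (n.choose 2 + 1) := fun h => by
  have h1 := h.le_of_forall fun S hS => syncIn_of_pairs hp 0 hS
  have h2 := card_openPairs_le (f := f) 0
  omega

theorem syncParams_ok {f : α → Fin 5 → Fin 5}
    (hp : ∀ P : Finset (Fin 5), P.card = 2 → ∃ i, SyncIn f i P)
    (hbad : LevelsUpTo f 3 14 ∨ LevelsUpTo f 4 16) : syncParams.OK f := by
  have hthr : ∀ c c', HitWithin f 3 c → HitWithin f 4 c' → ∀ j,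
      14 ≤ j + ((openPairs f j).card + c) ∨ 16 ≤ j + ((openPairs f j).card + (c + c')) := by
    intro c c' h3 h4 j
    rcases hbad with h | h
    · have := h.le_of_hitWithin_three hp h3 j
      omega
    · have := h.le_of_hitWithin_four hp h3 h4 j
      omega
  refine ⟨fun j => ?_, fun lev rem hrem h => ?_, fun lev rem hrem h => ?_, hthr⟩
  · have hall : ∀ P : Finset (Fin 5), P.card = 2 → SyncIn f (j + (openPairs f j).card) P :=
      fun P hP => syncIn_of_pairs hp j hP.le
    have := hthr _ _ (hitWithin_of_pairs (by omega) hall) (hitWithin_of_pairs (by omega) hall) j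
    change 6 ≤ _
    omega
  · exact hitWithin_of_allHit hrem (by decide +kernel) bitSet_five_injOn h
  · exact hitWithin_of_allHit hrem (by decide +kernel) bitSet_five_injOn h

theorem not_levelsUpTo_five_of_standard {f : α → Fin 5 → Fin 5}
    (hp : ∀ P : Finset (Fin 5), P.card = 2 → ∃ i, SyncIn f i P) (hP : syncParams.OK f)
    (h1 : SyncAt f 1 (bitSet 5 3))
    (h2 : SyncAt f 2 (bitSet 5 5) ∨ SyncAt f 2 (bitSet 5 12)) :
    ¬ LevelsUpTo f 3 14 ∧ ¬ LevelsUpTo f 4 16 := by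
  have key : ∀ y z, (y ≠ 0 → ∀ j, 1 ≤ j → j ≤ 20 → (SyncAt f j (bitSet 5 5) ↔ y = j)) →
      (z ≠ 0 → ∀ j, 1 ≤ j → j ≤ 20 → (SyncAt f j (bitSet 5 12) ↔ z = j)) →
      search 5 syncParams true 14 16 singleData (pairData 1 y z) tripleData quadData
        (fullMask 5) = true → ¬ LevelsUpTo f 3 14 ∧ ¬ LevelsUpTo f 4 16 := fun y z hy hz =>
    search_sound le_rfl (by omega) hP singleData_five (by decide +kernel) (pairData_five 1 y z)
      (fun S hS => exists_pairData_five 1 y z hS) (pairData_lvl (fun _ j _ _ => h1.iff j) hy hz)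
      (fun _ t ht _ => hp _ (pairData_five 1 y z t ht).2.2)
      tripleData_five tripleData_lvl
      (fun S hS hi => exists_data_of_codes
        (by clear hi; revert S; decide +kernel))
      quadData_five quadData_lvl
      (fun S hS hi => exists_data_of_codes
        (by clear hi; revert S; decide +kernel))
      hasLetter_fullMask
  rcases h2 with h2 | h2
  · exact key 2 0 (fun _ j _ _ => h2.iff j) (fun h => absurd rfl h) search_five_adjacent
  · exact key 0 2 (fun h => absurd rfl h) (fun _ j _ _ => h2.iff j) search_five_disjoint

theorem not_levelsUpTo_five {f : α → Fin 5 → Fin 5}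
    (hp : ∀ P : Finset (Fin 5), P.card = 2 → ∃ i, SyncIn f i P) :
    ¬ LevelsUpTo f 3 14 ∧ ¬ LevelsUpTo f 4 16 := by
  by_contra hbad
  rw [← not_or, not_not] at hbad
  have hmin := (syncParams_ok hp hbad).minTot
  obtain ⟨σ, h1, h2⟩ := exists_conj_of_pairs exists_perm_five hp
    (by have := hmin 0; simp only [syncParams] at this; omega)
    (by have := hmin 1; simp only [syncParams] at this; omega)
  have hp' := forall_exists_syncIn_conj σ hp
  have := not_levelsUpTo_five_of_standard hp'
    (syncParams_ok hp' (hbad.imp (levelsUpTo_conj σ) (levelsUpTo_conj σ))) h1 h2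
  exact hbad.elim (levelsUpTo_of_conj σ this.1) (levelsUpTo_of_conj σ this.2)

theorem not_levelsUpTo_four_of_standard {f : α → Fin 4 → Fin 4}
    (hp : ∀ P : Finset (Fin 4), P.card = 2 → ∃ i, SyncIn f i P) (hP : (countParams 5).OK f)
    (h1 : SyncAt f 1 (bitSet 4 3))
    (h2 : SyncAt f 2 (bitSet 4 5) ∨ SyncAt f 2 (bitSet 4 12)) : ¬ LevelsUpTo f 3 9 := by
  have key : ∀ y z, (y ≠ 0 → ∀ j, 1 ≤ j → j ≤ 20 → (SyncAt f j (bitSet 4 5) ↔ y = j)) →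
      (z ≠ 0 → ∀ j, 1 ≤ j → j ≤ 20 → (SyncAt f j (bitSet 4 12) ↔ z = j)) →
      search 4 (countParams 5) true 9 10 (singleData.take 4) ((pairData 1 y z).take 6)
        (tripleData.take 4) (quadData.take 1) (fullMask 4) = true → ¬ LevelsUpTo f 3 9 := by
    intro y z hy hz h
    have hpair : DataOK 4 2 ((pairData 1 y z).take 6) :=
      dataOK_of_codes (fun t ht => pairData_act 1 y z t (List.mem_of_mem_take ht))
        (show ∀ b ∈ ((pairData 0 0 0).take 6).map Prod.fst, _ by decide +kernel)
    refine (search_sound (by omega) (by omega) hP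
      (dataOK_of_codes (fun t ht => singleData_act t (List.mem_of_mem_take ht)) (by decide +kernel))
      (by decide +kernel) hpair
      (fun S hS => exists_data_of_codes
        (show ∃ b ∈ ((pairData 0 0 0).take 6).map Prod.fst, _ by revert S; decide +kernel))
      (fun t ht => pairData_lvl (fun _ j _ _ => h1.iff j) hy hz t (List.mem_of_mem_take ht))
      (fun _ t ht _ => hp _ (hpair t ht).2.2)
      (dataOK_of_codes (fun t ht => tripleData_act t (List.mem_of_mem_take ht)) (by decide +kernel))
      (fun t ht => tripleData_lvl t (List.mem_of_mem_take ht))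
      (fun S hS hi => exists_data_of_codes
        (by clear hi; revert S; decide +kernel))
      (dataOK_of_codes (fun t ht => quadData_act t (List.mem_of_mem_take ht)) (by decide +kernel))
      (fun t ht => quadData_lvl t (List.mem_of_mem_take ht))
      (fun S hS hi => exists_data_of_codes
        (by clear hi; revert S; decide +kernel))
      hasLetter_fullMask h).1
  rcases h2 with h2 | h2
  · exact key 2 0 (fun _ j _ _ => h2.iff j) (fun h => absurd rfl h) search_four_adjacent
  · exact key 0 2 (fun h => absurd rfl h) (fun _ j _ _ => h2.iff j) search_four_disjoint

theorem not_levelsUpTo_four {f : α → Fin 4 → Fin 4}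
    (hp : ∀ P : Finset (Fin 4), P.card = 2 → ∃ i, SyncIn f i P) : ¬ LevelsUpTo f 3 9 := by
  intro hbad
  have hOK : ∀ {g : α → Fin 4 → Fin 4},
      (∀ P : Finset (Fin 4), P.card = 2 → ∃ i, SyncIn g i P) → LevelsUpTo g 3 9 →
      (countParams 5).OK g := fun hp h => countParams_ok fun j => by
    have := h.le_of_hitWithin_three hp
      (hitWithin_of_pairs (by omega) fun P hP => syncIn_of_pairs hp j hP.le) j
    omega
  have hmin := (hOK hp hbad).minTot
  obtain ⟨σ, h1, h2⟩ := exists_conj_of_pairs exists_perm_four hp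
    (by have := hmin 0; simp only [countParams] at this; omega)
    (by have := hmin 1; simp only [countParams] at this; omega)
  have hp' := forall_exists_syncIn_conj σ hp
  exact levelsUpTo_of_conj σ
    (not_levelsUpTo_four_of_standard hp' (hOK hp' (levelsUpTo_conj σ hbad)) h1 h2) hbad

end Synchronizing

section NonSynchronizing

variable {n : ℕ} {α : Type} {f : α → Fin n → Fin n}

/-- Counting the levels above `j` when the pairs in `N` can never be merged. -/
theorem LevelsUpTo.le_of_never {k L : ℕ} {N : Finset (Finset (Fin n))}
    (hN : ∀ P ∈ N, P.card = 2 ∧ ∀ i, ¬ SyncIn f i P) (h : LevelsUpTo f k L) (j : ℕ) :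
    L + N.card ≤ j + (openPairs f j).card +
      (Finset.univ.filter fun S : Finset (Fin n) =>
        2 < S.card ∧ S.card ≤ k ∧ ∀ P ∈ N, ¬ P ⊆ S).card :=
  h.le_of_card N _ hN (fun _ h2 hk ⟨i, hi⟩ => Finset.mem_filter.2
    ⟨Finset.mem_univ _, h2, hk, fun P hP hPS => (hN P hP).2 i (hi.anti hPS)⟩) j

theorem not_levelsUpTo_two_of_never {X : Finset (Fin n)} (hX : X.card = 2)
    (hnX : ∀ i, ¬ SyncIn f i X) : ¬ LevelsUpTo f 2 (n.choose 2) := fun h => by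
  have h1 := h.le_of_card {X} ∅ (by simpa using ⟨hX, hnX⟩) (fun _ h2 h3 _ => by omega) 0
  have h2 := card_openPairs_le (f := f) 0
  simp only [Finset.card_singleton, Finset.card_empty] at h1
  omega

theorem not_levelsUpTo_four_of_never {f : α → Fin 4 → Fin 4} {X : Finset (Fin 4)}
    (hX : X.card = 2) (hnX : ∀ i, ¬ SyncIn f i X) : ¬ LevelsUpTo f 3 8 := fun h => by
  have h1 := h.le_of_never (N := {X}) (by simpa using ⟨hX, hnX⟩) 0
  have h2 := card_openPairs_le (f := f) 0
  have h3 : ∀ X : Finset (Fin 4), X.card = 2 → (Finset.univ.filter fun S : Finset (Fin 4) =>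
      2 < S.card ∧ S.card ≤ 3 ∧ ∀ P ∈ ({X} : Finset (Finset (Fin 4))), ¬ P ⊆ S).card ≤ 2 := by
    decide +kernel
  have h3 := h3 X hX
  rw [Finset.card_singleton] at h1
  have : Nat.choose 4 2 = 6 := rfl
  omega

/-- The bound on the number of open pairs when the pairs in `N` can never be merged. -/
theorem le_add_card_openPairs_of_never {f : α → Fin n → Fin n} {N : Finset (Finset (Fin n))}
    {m L3 L4 : ℕ} (hN : ∀ P ∈ N, P.card = 2 ∧ ∀ i, ¬ SyncIn f i P)
    (hbad : LevelsUpTo f 3 L3 ∨ LevelsUpTo f 4 L4)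
    (h3 : m + (Finset.univ.filter fun S : Finset (Fin n) =>
      2 < S.card ∧ S.card ≤ 3 ∧ ∀ P ∈ N, ¬ P ⊆ S).card ≤ L3 + N.card)
    (h4 : m + (Finset.univ.filter fun S : Finset (Fin n) =>
      2 < S.card ∧ S.card ≤ 4 ∧ ∀ P ∈ N, ¬ P ⊆ S).card ≤ L4 + N.card) (j : ℕ) :
    m ≤ j + (openPairs f j).card := by
  rcases hbad with h | h
  · have := h.le_of_never hN j
    omega
  · have := h.le_of_never hN j
    omega

theorem HasLetter.land {f : α → Fin n → Fin n} {V W : ℕ} {a : α} (hV : HasLetter f V a)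
    (hW : HasLetter f W a) : HasLetter f (Nat.land V W) a := by
  change (V &&& W).testBit _ = true
  rw [Nat.testBit_and, Bool.and_eq_true]
  exact ⟨hV, hW⟩

theorem hasLetter_stableMask {f : α → Fin (n + 2) → Fin (n + 2)} {a : α}
    (ha : ∀ p ∈ bitSet (n + 2) 3, f a p ∈ bitSet (n + 2) 3) :
    HasLetter f (stableMask (n + 2)) a := by
  have key : ∀ p : Fin (n + 2), p ∈ bitSet (n + 2) 3 →
      HasLetter f (Nat.shiftLeft (preMask (n + 2) 3 p) 64) a := fun p hp =>
    hasLetter_scramble.1 ((hasLetter_preMask 3 a p).2 (ha p hp))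
  exact ((hasLetter_fullMask a).land (key 0 (by simp [bitSet]))).land
    (key 1 (by simp [bitSet, Nat.testBit]))

/-- Exactly one pair can never be merged. -/
theorem not_levelsUpTo_five_of_unique_standard {f : α → Fin 5 → Fin 5}
    (hX : ∀ i, ¬ SyncIn f i (bitSet 5 3))
    (hp : ∀ P : Finset (Fin 5), P.card = 2 → P ≠ bitSet 5 3 → ∃ i, SyncIn f i P) :
    ¬ LevelsUpTo f 3 13 ∧ ¬ LevelsUpTo f 4 15 := by
  by_contra hbad
  rw [← not_or, not_not] at hbad
  have hX2 : (bitSet 5 3).card = 2 := by decide +kernel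
  have hOK : (countParams 7).OK f := countParams_ok
    (le_add_card_openPairs_of_never (N := {bitSet 5 3}) (by simpa using ⟨hX2, hX⟩) hbad
      (by decide +kernel) (by decide +kernel))
  have hstable : ∀ a, (bitSet 5 3).image (f a) = bitSet 5 3 := fun a => by
    have hno : ∀ i, ¬ SyncIn f i ((bitSet 5 3).image (f a)) := fun i hi =>
      hX (i + 1) (Or.inr ⟨a, hi⟩)
    by_contra hne
    have h1 : 1 < ((bitSet 5 3).image (f a)).card := not_le.1 (hno 0)
    have h2 : ((bitSet 5 3).image (f a)).card ≤ 2 := Finset.card_image_le.trans hX2.le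
    obtain ⟨i, hi⟩ := hp _ (by omega) hne
    exact hno i hi
  have havoid : ∀ S : Finset (Fin 5), (∃ i, SyncIn f i S) → ¬ bitSet 5 3 ⊆ S :=
    fun S ⟨i, hi⟩ hs => hX i (hi.anti hs)
  have hcode : ∀ b ∈ ((pairData 99 0 0).filter fun t => t.2.2 = 0).map Prod.fst,
      bitSet 5 b ≠ bitSet 5 3 := by decide +kernel
  have := search_sound le_rfl (by omega) hOK singleData_five (by decide +kernel)
    (pairData_five 99 0 0) (fun S hS => exists_pairData_five 99 0 0 hS)
    (pairData_lvl (fun _ j _ hj => syncAt_iff_of_never hX hj) (fun h => absurd rfl h)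
      (fun h => absurd rfl h))
    (fun _ t ht h0 => hp _ (pairData_five 99 0 0 t ht).2.2
      (hcode _ (List.mem_map_of_mem (List.mem_filter.2 ⟨ht, by simpa using h0⟩))))
    (tripleData_five.sublist (avoid_sublist 3 _))
    (fun t ht => tripleData_lvl t ((avoid_sublist 3 _).subset ht))
    (fun S hS hi => exists_data_of_codes
      (by replace hi := havoid S hi; revert S; decide +kernel))
    (quadData_five.sublist (avoid_sublist 3 _))
    (fun t ht => quadData_lvl t ((avoid_sublist 3 _).subset ht))
    (fun S hS hi => exists_data_of_codes
      (by replace hi := havoid S hi; revert S; decide +kernel))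
    (fun a => hasLetter_stableMask (n := 3) fun p hp => hstable a ▸ Finset.mem_image_of_mem _ hp)
    search_stable
  exact hbad.elim this.1 this.2

/-- At least two pairs can never be merged. -/
theorem not_levelsUpTo_five_of_two_standard {f : α → Fin 5 → Fin 5}
    (hX : ∀ i, ¬ SyncIn f i (bitSet 5 3))
    (hY : (∀ i, ¬ SyncIn f i (bitSet 5 5)) ∨ ∀ i, ¬ SyncIn f i (bitSet 5 12)) :
    ¬ LevelsUpTo f 3 13 ∧ ¬ LevelsUpTo f 4 15 := by
  by_contra hbad
  rw [← not_or, not_not] at hbad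
  have hX2 : (bitSet 5 3).card = 2 := by decide +kernel
  have key : ∀ (c m y z : ℕ), (bitSet 5 c).card = 2 → (∀ i, ¬ SyncIn f i (bitSet 5 c)) →
      (countParams m).OK f →
      (y ≠ 0 → ∀ j, 1 ≤ j → j ≤ 20 → (SyncAt f j (bitSet 5 5) ↔ y = j)) →
      (z ≠ 0 → ∀ j, 1 ≤ j → j ≤ 20 → (SyncAt f j (bitSet 5 12) ↔ z = j)) →
      (∀ S : Finset (Fin 5), S.card = 3 → ¬ bitSet 5 3 ⊆ S ∧ ¬ bitSet 5 c ⊆ S →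
        ∃ b ∈ (avoid c (avoid 3 tripleData)).map Prod.fst, bitSet 5 b = S) →
      (∀ S : Finset (Fin 5), S.card = 4 → ¬ bitSet 5 3 ⊆ S ∧ ¬ bitSet 5 c ⊆ S →
        ∃ b ∈ (avoid c (avoid 3 quadData)).map Prod.fst, bitSet 5 b = S) →
      search 5 (countParams m) false 13 15 singleData (pairData 99 y z)
        (avoid c (avoid 3 tripleData)) (avoid c (avoid 3 quadData)) (fullMask 5) = true →
      False := by
    intro c m y z hc2 hc hOK hy hz ht hq h
    have havoid : ∀ S : Finset (Fin 5), (∃ i, SyncIn f i S) →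
        ¬ bitSet 5 3 ⊆ S ∧ ¬ bitSet 5 c ⊆ S :=
      fun S ⟨i, hi⟩ => ⟨fun hs => hX i (hi.anti hs), fun hs => hc i (hi.anti hs)⟩
    have hsub : ∀ l, (avoid c (avoid 3 l)).Sublist l := fun l =>
      (avoid_sublist c _).trans (avoid_sublist 3 l)
    have := search_sound le_rfl (by omega) hOK singleData_five (by decide +kernel)
      (pairData_five 99 y z) (fun S hS => exists_pairData_five 99 y z hS)
      (pairData_lvl (fun _ j _ hj => syncAt_iff_of_never hX hj) hy hz)
      (fun h => absurd h Bool.false_ne_true)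
      (tripleData_five.sublist (hsub _)) (fun t ht => tripleData_lvl t ((hsub _).subset ht))
      (fun S hS hi => exists_data_of_codes (ht S hS (havoid S hi)))
      (quadData_five.sublist (hsub _)) (fun t ht => quadData_lvl t ((hsub _).subset ht))
      (fun S hS hi => exists_data_of_codes (hq S hS (havoid S hi))) hasLetter_fullMask h
    exact hbad.elim this.1 this.2
  rcases hY with hY | hY
  · have hY2 : (bitSet 5 5).card = 2 := by decide +kernel
    exact key 5 10 99 0 hY2 hY
      (countParams_ok (le_add_card_openPairs_of_never (N := {bitSet 5 3, bitSet 5 5})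
        (by simpa using ⟨⟨hX2, hX⟩, hY2, hY⟩) hbad (by decide +kernel) (by decide +kernel)))
      (fun _ j _ hj => syncAt_iff_of_never hY hj) (fun h => absurd rfl h)
      (by decide +kernel) (by decide +kernel) search_unmerged_adjacent
  · have hY2 : (bitSet 5 12).card = 2 := by decide +kernel
    exact key 12 11 0 99 hY2 hY
      (countParams_ok (le_add_card_openPairs_of_never (N := {bitSet 5 3, bitSet 5 12})
        (by simpa using ⟨⟨hX2, hX⟩, hY2, hY⟩) hbad (by decide +kernel) (by decide +kernel)))
      (fun h => absurd rfl h) (fun _ j _ hj => syncAt_iff_of_never hY hj)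
      (by decide +kernel) (by decide +kernel) search_unmerged_disjoint

theorem not_levelsUpTo_five_of_never {f : α → Fin 5 → Fin 5} {X : Finset (Fin 5)}
    (hX : X.card = 2) (hnX : ∀ i, ¬ SyncIn f i X) :
    ¬ LevelsUpTo f 3 13 ∧ ¬ LevelsUpTo f 4 15 := by
  have hconj : ∀ (σ : Equiv.Perm (Fin 5)) (P : Finset (Fin 5)),
      (∀ i, ¬ SyncIn f i (P.image σ)) → ∀ i, ¬ SyncIn (fun a p => σ.symm (f a (σ p))) i P :=
    fun σ P h i hi => h i ((syncIn_conj σ).1 hi)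
  by_cases hY : ∃ Y : Finset (Fin 5), Y.card = 2 ∧ Y ≠ X ∧ ∀ i, ¬ SyncIn f i Y
  · obtain ⟨Y, hY, hne, hnY⟩ := hY
    obtain ⟨σ, h3, h⟩ := exists_perm_five X Y hX hY hne.symm
    have := not_levelsUpTo_five_of_two_standard (hconj σ _ (h3 ▸ hnX))
      (h.imp (fun h : (bitSet 5 5).image σ = Y => hconj σ _ (h ▸ hnY))
        fun h : (bitSet 5 12).image σ = Y => hconj σ _ (h ▸ hnY))
    exact ⟨levelsUpTo_of_conj σ this.1, levelsUpTo_of_conj σ this.2⟩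
  · have hother : ∀ X : Finset (Fin 5), X.card = 2 → ∃ Y : Finset (Fin 5), Y.card = 2 ∧ X ≠ Y := by
      decide +kernel
    obtain ⟨Y, hY2, hne⟩ := hother X hX
    obtain ⟨σ, h3, -⟩ := exists_perm_five X Y hX hY2 hne
    have := not_levelsUpTo_five_of_unique_standard (hconj σ _ (h3 ▸ hnX)) fun P hP hPX => by
      by_contra! hn
      refine hY ⟨P.image σ, ?_, fun he => hPX ?_, fun i hi => hn i ((syncIn_conj σ).2 hi)⟩
      · rw [Finset.card_image_of_injective _ σ.injective, hP]
      · exact Finset.image_injective σ.injective (he.trans h3.symm)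
    exact ⟨levelsUpTo_of_conj σ this.1, levelsUpTo_of_conj σ this.2⟩

end NonSynchronizing

section Words

variable {n m : ℕ}

theorem syncIn_iff_exists_word {δ : Fin n → Fin m → Fin n} {i : ℕ} {S : Finset (Fin n)} :
    SyncIn (fun a q => δ q a) i S ↔ ∃ w, w.length ≤ i ∧ (dfaRun δ S w).card ≤ 1 := by
  induction i generalizing S with
  | zero =>
    refine ⟨fun h => ⟨[], le_rfl, h⟩, fun ⟨w, hw, h⟩ => ?_⟩
    obtain rfl : w = [] := List.length_eq_zero_iff.1 (Nat.le_zero.1 hw)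
    exact h
  | succ i ih =>
    refine ⟨fun h => ?_, fun ⟨w, hw, h⟩ => ?_⟩
    · rcases h with h | ⟨a, h⟩
      · obtain ⟨w, hw, h⟩ := ih.1 h
        exact ⟨w, by omega, h⟩
      · obtain ⟨w, hw, h⟩ := ih.1 h
        exact ⟨a :: w, Nat.succ_le_succ hw, h⟩
    · cases w with
      | nil => exact Or.inl (ih.2 ⟨[], Nat.zero_le _, h⟩)
      | cons a w => exact Or.inr ⟨a, ih.2 ⟨w, Nat.le_of_succ_le_succ hw, h⟩⟩

theorem dfaRun_nonempty (δ : Fin n → Fin m → Fin n) {S : Finset (Fin n)} (hS : S.Nonempty)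
    (w : List (Fin m)) : (dfaRun δ S w).Nonempty := by
  induction w generalizing S with
  | nil => exact hS
  | cons a w ih => exact ih (hS.image _)

theorem dfaSync_iff {δ : Fin n → Fin m → Fin n} {S : Finset (Fin n)} (hS : S.Nonempty)
    {w : List (Fin m)} : dfaSync δ S w ↔ (dfaRun δ S w).card ≤ 1 := by
  have := (dfaRun_nonempty δ hS w).card_pos
  unfold dfaSync
  omega

theorem exists_dfaSync_iff {δ : Fin n → Fin m → Fin n} {S : Finset (Fin n)} (hS : S.Nonempty) :
    (∃ w, dfaSync δ S w) ↔ ∃ i, SyncIn (fun a q => δ q a) i S := by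
  simp only [syncIn_iff_exists_word, dfaSync_iff hS]
  exact ⟨fun ⟨w, h⟩ => ⟨_, w, le_rfl, h⟩, fun ⟨_, w, _, h⟩ => ⟨w, h⟩⟩

theorem dfaShortestSync_iff {δ : Fin n → Fin m → Fin n} {S : Finset (Fin n)} (hS : S.Nonempty)
    {l : ℕ} : dfaShortestSync δ S l ↔ SyncAt (fun a q => δ q a) l S := by
  simp only [SyncAt, dfaShortestSync, syncIn_iff_exists_word, dfaSync_iff hS]
  constructor
  · rintro ⟨⟨w, hw, hl⟩, hmin⟩
    refine ⟨⟨w, hl.le, hw⟩, fun j hj ⟨v, hv, hv'⟩ => ?_⟩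
    have := hmin v hv'
    omega
  · rintro ⟨⟨w, hl, hw⟩, hmin⟩
    have hle : ∀ v, (dfaRun δ S v).card ≤ 1 → l ≤ v.length := fun v hv => by
      by_contra hc
      exact hmin v.length (by omega) ⟨v, le_rfl, hv⟩
    exact ⟨⟨w, hw, le_antisymm hl (hle w hw)⟩, hle⟩

end Words

section Bounds

variable {n k l : ℕ} {α : Type} {f : α → Fin n → Fin n}

theorem lt_of_not_levelsUpTo {L : ℕ} {S : Finset (Fin n)} (hS : S.card = k) (h : SyncAt f l S)
    (hL : ¬ LevelsUpTo f k L) : l < L := by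
  by_contra hc
  exact hL ((h.levelsUpTo hS.le).mono (not_lt.1 hc))

theorem not_levelsUpTo_of_pairs (hn3 : 3 ≤ n) (hn : n ≤ 5) (hk : 2 ≤ k) (hkn : k ≤ n)
    (hp : ∀ P : Finset (Fin n), P.card = 2 → ∃ i, SyncIn f i P) :
    ¬ LevelsUpTo f k (T0 n k + 1) := by
  have h2 := not_levelsUpTo_two_of_pairs hp
  interval_cases n
  · interval_cases k
    · exact h2
    · exact fun h => h2 (h.pred rfl)
  · interval_cases k
    · exact h2
    · exact not_levelsUpTo_four hp
    · exact fun h => not_levelsUpTo_four hp (h.pred rfl)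
  · interval_cases k
    · exact h2
    · exact (not_levelsUpTo_five hp).1
    · exact (not_levelsUpTo_five hp).2
    · exact fun h => (not_levelsUpTo_five hp).2 (h.pred rfl)

theorem not_levelsUpTo_of_never (hn3 : 3 ≤ n) (hn : n ≤ 5) (hk : 2 ≤ k) (hkn : k < n)
    {X : Finset (Fin n)} (hX : X.card = 2) (hnX : ∀ i, ¬ SyncIn f i X) :
    ¬ LevelsUpTo f k (T0 n k) := by
  have h2 := not_levelsUpTo_two_of_never hX hnX
  interval_cases n
  · interval_cases k
    exact h2
  · interval_cases k
    · exact h2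
    · exact not_levelsUpTo_four_of_never hX hnX
  · interval_cases k
    · exact h2
    · exact (not_levelsUpTo_five_of_never hX hnX).1
    · exact (not_levelsUpTo_five_of_never hX hnX).2

theorem lt_of_syncAt_of_never (hn3 : 3 ≤ n) (hn : n ≤ 5) (hk : 2 ≤ k) (hkn : k ≤ n)
    {X : Finset (Fin n)} (hX : X.card = 2) (hnX : ∀ i, ¬ SyncIn f i X) {S : Finset (Fin n)}
    (hS : S.card = k) (h : SyncAt f l S) : l < T0 n k := by
  refine lt_of_not_levelsUpTo hS h (not_levelsUpTo_of_never hn3 hn hk ?_ hX hnX)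
  refine lt_of_le_of_ne hkn fun hkn => hnX l (h.1.anti ?_)
  have hu : S = Finset.univ := by rw [← Finset.card_eq_iff_eq_univ, Fintype.card_fin, hS, hkn]
  exact hu ▸ Finset.subset_univ X

theorem le_of_syncAt (hn3 : 3 ≤ n) (hn : n ≤ 5) (hk : 2 ≤ k) (hkn : k ≤ n)
    {S : Finset (Fin n)} (hS : S.card = k) (h : SyncAt f l S) : l ≤ T0 n k := by
  by_cases hp : ∀ P : Finset (Fin n), P.card = 2 → ∃ i, SyncIn f i P
  · exact Nat.le_of_lt_succ
      (lt_of_not_levelsUpTo hS h (not_levelsUpTo_of_pairs hn3 hn hk hkn hp))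
  · push Not at hp
    obtain ⟨X, hX, hnX⟩ := hp
    exact (lt_of_syncAt_of_never hn3 hn hk hkn hX hnX hS h).le

end Bounds

section Cerny

variable {n : ℕ}

/-- A function with the local properties of the distance to the sets of at most one state is that
distance. -/
theorem syncAt_of_distance {α : Type} {f : α → Fin n → Fin n} {g : Finset (Fin n) → ℕ}
    (h0 : ∀ S, g S = 0 ↔ S.card ≤ 1) (hle : ∀ S a, g S ≤ g (S.image (f a)) + 1)
    (hex : ∀ S, g S ≠ 0 → ∃ a, g (S.image (f a)) + 1 = g S) {l : ℕ}
    (S : Finset (Fin n)) (hl : g S = l) : SyncAt f l S := by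
  subst hl
  have hup : ∀ i S, g S ≤ i → SyncIn f i S := by
    intro i
    induction i with
    | zero => exact fun S h => (h0 S).1 (Nat.le_zero.1 h)
    | succ i ih =>
      intro S h
      by_cases hS : g S = 0
      · exact syncIn_of_card_le_one ((h0 S).1 hS) _
      · obtain ⟨a, ha⟩ := hex S hS
        exact Or.inr ⟨a, ih _ (by omega)⟩
  have hlow : ∀ i S, SyncIn f i S → g S ≤ i := by
    intro i
    induction i with
    | zero => exact fun S h => ((h0 S).2 h).le
    | succ i ih =>
      rintro S (h | ⟨a, h⟩)
      · exact (ih S h).trans (Nat.le_succ i)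
      · exact (hle S a).trans (Nat.succ_le_succ (ih _ h))
  exact ⟨hup _ S le_rfl, fun j hj h => absurd (hlow j S h) (not_le.2 hj)⟩

/-- The Černý automaton: the letter `0` is a cyclic shift of the states, the letter `1` maps the
last state to the first one and fixes the others. -/
def cerny (q : Fin (n + 1)) (a : Fin 2) : Fin (n + 1) :=
  if a = 0 then q + 1 else if q = Fin.last n then 0 else q

/-- The value that the table `t` stores at the position with binary digits `S`. -/
def tableValue (t : List ℕ) (S : Finset (Fin n)) : ℕ := t.getD (∑ p ∈ S, 2 ^ (p : ℕ)) 0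

theorem exists_syncAt_cerny_three (k : ℕ) (hk : 2 ≤ k) (hkn : k ≤ 3) :
    ∃ S : Finset (Fin 3), S.card = k ∧ SyncAt (fun a q => cerny q a) (T0 3 k) S := by
  have h := syncAt_of_distance (f := fun a (q : Fin 3) => cerny q a)
    (g := tableValue [0, 0, 0, 3, 0, 1, 2, 4])
    (by decide +kernel) (by decide +kernel) (by decide +kernel) (l := T0 3 k)
  interval_cases k
  · exact ⟨{0, 1}, rfl, h _ (by decide +kernel)⟩
  · exact ⟨Finset.univ, rfl, h _ (by decide +kernel)⟩

theorem exists_syncAt_cerny_four (k : ℕ) (hk : 2 ≤ k) (hkn : k ≤ 4) :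
    ∃ S : Finset (Fin 4), S.card = k ∧ SyncAt (fun a q => cerny q a) (T0 4 k) S := by
  have h := syncAt_of_distance (f := fun a (q : Fin 4) => cerny q a)
    (g := tableValue [0, 0, 0, 4, 0, 6, 3, 8, 0, 1, 5, 5, 2, 6, 7, 9])
    (by decide +kernel) (by decide +kernel) (by decide +kernel) (l := T0 4 k)
  interval_cases k
  · exact ⟨{0, 2}, rfl, h _ (by decide +kernel)⟩
  · exact ⟨{0, 1, 2}, rfl, h _ (by decide +kernel)⟩
  · exact ⟨Finset.univ, rfl, h _ (by decide +kernel)⟩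

theorem exists_syncAt_cerny_five (k : ℕ) (hk : 2 ≤ k) (hkn : k ≤ 5) :
    ∃ S : Finset (Fin 5), S.card = k ∧ SyncAt (fun a q => cerny q a) (T0 5 k) S := by
  have h := syncAt_of_distance (f := fun a (q : Fin 5) => cerny q a)
    (g := tableValue [0, 0, 0, 5, 0, 10, 4, 10, 0, 7, 9, 12, 3, 13, 9, 15, 0, 1, 6, 6, 8, 11, 11,
      11, 2, 7, 12, 12, 8, 13, 14, 16])
    (by decide +kernel) (by decide +kernel) (by decide +kernel) (l := T0 5 k)
  interval_cases k
  · exact ⟨{0, 2}, rfl, h _ (by decide +kernel)⟩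
  · exact ⟨{0, 2, 3}, rfl, h _ (by decide +kernel)⟩
  · exact ⟨{0, 1, 2, 3}, rfl, h _ (by decide +kernel)⟩
  · exact ⟨Finset.univ, rfl, h _ (by decide +kernel)⟩

theorem exists_dfaShortestSync (n k : ℕ) (hn3 : 3 ≤ n) (hn : n ≤ 5) (hk : 2 ≤ k) (hkn : k ≤ n) :
    ∃ (m : ℕ) (δ : Fin n → Fin m → Fin n) (S : Finset (Fin n)),
      S.card = k ∧ dfaShortestSync δ S (T0 n k) := by
  have key : ∀ {n : ℕ} {δ : Fin n → Fin 2 → Fin n},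
      (∃ S : Finset (Fin n), S.card = k ∧ SyncAt (fun a q => δ q a) (T0 n k) S) →
      ∃ (m : ℕ) (δ : Fin n → Fin m → Fin n) (S : Finset (Fin n)),
        S.card = k ∧ dfaShortestSync δ S (T0 n k) := fun ⟨S, hS, h⟩ =>
    ⟨2, _, S, hS, (dfaShortestSync_iff (Finset.card_pos.1 (by omega))).2 h⟩
  interval_cases n
  · exact key (exists_syncAt_cerny_three k hk hkn)
  · exact key (exists_syncAt_cerny_four k hk hkn)
  · exact key (exists_syncAt_cerny_five k hk hkn)

end Cerny

theorem stmt0 (n k : ℕ) (hn3 : 3 ≤ n) (hn : n ≤ 5) (hk : 2 ≤ k) (hkn : k ≤ n) :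
    IsGreatest {l : ℕ | ∃ (m : ℕ) (δ : Fin n → Fin m → Fin n) (S : Finset (Fin n)),
      S.card = k ∧ dfaShortestSync δ S l} (T0 n k) ∧
    (∀ (m : ℕ) (δ : Fin n → Fin m → Fin n) (S : Finset (Fin n)) (l : ℕ),
      S.card = k → ¬ (∃ w, dfaSync δ Finset.univ w) →
      dfaShortestSync δ S l → l < T0 n k) := by
  refine ⟨⟨exists_dfaShortestSync n k hn3 hn hk hkn, ?_⟩, ?_⟩
  · rintro l ⟨m, δ, S, hS, h⟩
    exact le_of_syncAt hn3 hn hk hkn hS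
      ((dfaShortestSync_iff (Finset.card_pos.1 (by omega))).1 h)
  · intro m δ S l hS hno h
    have hS0 : S.Nonempty := Finset.card_pos.1 (by omega)
    rw [exists_dfaSync_iff (hS0.mono (Finset.subset_univ S))] at hno
    have hp := mt (fun hp => exists_syncIn_of_pairs hp Finset.univ) hno
    push Not at hp
    obtain ⟨X, hX, hnX⟩ := hp
    exact lt_of_syncAt_of_never hn3 hn hk hkn hX hnX hS ((dfaShortestSync_iff hS0).1 h)
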